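/- arXiv:2509.17780 — 5 statements merged into one kernel-verified Lean document; each statement's English description precedes it below -/
import Mathlib

section
/- Let p be a prime and let n > 1 be an integer with p > 2n. If G is an extraspecial p-group of order p^(2n+1), then G has no automorphism of order p^n. -/
/-- A finite group `G` is an extraspecial `p`-group if its center, derived subgroup
and Frattini subgroup all coincide and have order `p`. -/
def IsExtraspecial (p : ℕ) (G : Type*) [Group G] : Prop :=
  IsPGroup p G ∧ Subgroup.center G = commutator G ∧
    commutator G = frattini G ∧ Nat.card (Subgroup.center G) = p

open scoped commutatorElement

theorem one_add_pow_prime_eq_one {R : Type*} [Ring R] {p : ℕ} (hp : p.Prime) {a : R}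
    (hpa : (p : R) * a = 0) (ha : a ^ p = 0) : (1 + a) ^ p = 1 := by
  rw [add_comm, (Commute.one_right a).add_pow_prime_eq hp, ha, hpa]
  simp

theorem isNilpotent_of_one_add_pow_prime_pow_eq_one {R : Type*} [Ring R] {p : ℕ}
    (hp : p.Prime) {a : R} {k : ℕ} (hpR : IsNilpotent (p : R)) (ha : (1 + a) ^ p ^ k = 1) :
    IsNilpotent a := by
  obtain ⟨r, hr⟩ := (Commute.one_left a).exists_add_pow_prime_pow_eq hp k
  have h : a ^ p ^ k = p * -(a * r) := by
    rw [ha, one_pow, add_assoc, left_eq_add] at hr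
    rw [mul_neg, eq_neg_of_add_eq_zero_left hr, mul_one, mul_assoc]
  have h' : IsNilpotent (a ^ p ^ k) := by
    rw [h]
    exact (Nat.cast_commute p _).isNilpotent_mul_right hpR
  exact IsNilpotent.of_pow h'

/-- A nilpotent endomorphism stabilizing a subgroup of order `p ^ m` has its `m`-th power
vanishing there. -/
theorem AddSubgroup.nilpotent_end_pow_apply_eq_zero {L : Type*} [AddCommGroup L] [Finite L]
    {p : ℕ} (hp : p.Prime) {A : AddMonoid.End L} (hA : IsNilpotent A) (m : ℕ)
    (S : AddSubgroup L) (hS : Nat.card S = p ^ m) (hAS : ∀ x ∈ S, A x ∈ S) :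
    ∀ x ∈ S, (A ^ m) x = 0 := by
  induction m using Nat.strong_induction_on generalizing S with
  | _ m ih =>
    have hle : S.map A ≤ S := by
      rintro _ ⟨x, hx, rfl⟩
      exact hAS x hx
    rcases hle.eq_or_lt with heq | hlt
    · obtain ⟨N, hN⟩ := hA
      have hsurj : ∀ j, ∀ x ∈ S, ∃ y ∈ S, (A ^ j) y = x := by
        intro j
        induction j with
        | zero => exact fun x hx => ⟨x, hx, rfl⟩
        | succ j hj =>
          intro x hx
          obtain ⟨y, hy, rfl⟩ := hj x hx
          rw [← heq] at hy
          obtain ⟨z, hz, rfl⟩ := hy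
          exact ⟨z, hz, by rw [pow_succ]; rfl⟩
      intro x hx
      obtain ⟨y, -, rfl⟩ := hsurj N x hx
      rw [hN]
      exact map_zero (A ^ m)
    · obtain ⟨j, -, hj⟩ := (Nat.dvd_prime_pow hp).1 (hS ▸ AddSubgroup.card_dvd_of_le hle)
      have hjm : j < m := by
        refine (Nat.pow_lt_pow_iff_right hp.one_lt).1 ?_
        rw [← hj, ← hS]
        exact Set.ncard_lt_ncard hlt (Set.toFinite _)
      have key := ih j hjm (S.map A) hj (by
        rintro x hx
        exact ⟨x, hle hx, rfl⟩)
      intro x hx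
      have h0 : (A ^ (j + 1)) x = 0 := by
        rw [pow_succ]
        exact key _ ⟨x, hx, rfl⟩
      obtain ⟨d, rfl⟩ := Nat.exists_eq_add_of_lt hjm
      rw [show j + d + 1 = d + (j + 1) by ring, pow_add]
      change (A ^ d) ((A ^ (j + 1)) x) = 0
      rw [h0, map_zero]

section ClassTwo

variable {G : Type*} [Group G]

theorem commutatorElement_mul_right_of_mem_center
    (hc : ∀ x y : G, ⁅x, y⁆ ∈ Subgroup.center G) (x y z : G) :
    ⁅x, y * z⁆ = ⁅x, y⁆ * ⁅x, z⁆ := by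
  have h := Subgroup.mem_center_iff.1 (hc x z) y
  calc ⁅x, y * z⁆ = ⁅x, y⁆ * (y * ⁅x, z⁆) * y⁻¹ := by
        simp only [commutatorElement_def]; group
    _ = _ := by rw [h]; group

theorem commutatorElement_mul_left_of_mem_center
    (hc : ∀ x y : G, ⁅x, y⁆ ∈ Subgroup.center G) (x y z : G) :
    ⁅x * y, z⁆ = ⁅x, z⁆ * ⁅y, z⁆ := by
  rw [← commutatorElement_inv, commutatorElement_mul_right_of_mem_center hc, mul_inv_rev,
    commutatorElement_inv, commutatorElement_inv, Subgroup.mem_center_iff.1 (hc x z)]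

theorem commutatorElement_pow_left_of_mem_center
    (hc : ∀ x y : G, ⁅x, y⁆ ∈ Subgroup.center G) (x y : G) (m : ℕ) :
    ⁅x ^ m, y⁆ = ⁅x, y⁆ ^ m := by
  induction m with
  | zero => simp
  | succ m ih => rw [pow_succ, commutatorElement_mul_left_of_mem_center hc, ih, pow_succ]

/-- The Baer trick: in a group of class two in which every commutator has the square root
`⁅x, y⁆ ^ k`, the operation `x * y * ⁅y, x⁆ ^ k` is an abelian group law. -/
abbrev baerAddCommGroup (k : ℕ) (hc : ∀ x y : G, ⁅x, y⁆ ∈ Subgroup.center G)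
    (hk : ∀ x y : G, ⁅x, y⁆ ^ (k + k) = ⁅x, y⁆) : AddCommGroup G :=
  letI : Add G := ⟨fun x y => x * y * ⁅y, x⁆ ^ k⟩
  letI : Zero G := ⟨1⟩
  letI : Neg G := ⟨fun x => x⁻¹⟩
  have hadd (x y : G) : x + y = x * y * ⁅y, x⁆ ^ k := rfl
  have hzero : (0 : G) = 1 := rfl
  have hneg (x : G) : -x = x⁻¹ := rfl
  have hcp (x y : G) : ⁅x, y⁆ ^ k ∈ Subgroup.center G := pow_mem (hc x y) k
  have hcl {c : G} (h : c ∈ Subgroup.center G) (x : G) : ⁅c, x⁆ = 1 :=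
    commutatorElement_eq_one_iff_mul_comm.2 (Subgroup.mem_center_iff.1 h x).symm
  have hcr {c : G} (h : c ∈ Subgroup.center G) (x : G) : ⁅x, c⁆ = 1 :=
    commutatorElement_eq_one_iff_mul_comm.2 (Subgroup.mem_center_iff.1 h x)
  { nsmul := nsmulRec
    zsmul := zsmulRec
    add_assoc := fun x y z => by
      have hcomm (a b c d : G) : Commute ⁅a, b⁆ ⁅c, d⁆ :=
        Subgroup.mem_center_iff.1 (hc c d) _
      simp only [hadd, commutatorElement_mul_right_of_mem_center hc,
        commutatorElement_mul_left_of_mem_center hc, hcl (hcp _ _), hcr (hcp _ _), mul_one,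
        (hcomm _ _ _ _).mul_pow]
      have h1 : ⁅y, x⁆ ^ k * z = z * ⁅y, x⁆ ^ k :=
        (Subgroup.mem_center_iff.1 (hcp y x) z).symm
      have h2 : ⁅y, x⁆ ^ k * (⁅z, x⁆ ^ k * ⁅z, y⁆ ^ k) =
          ⁅z, y⁆ ^ k * (⁅y, x⁆ ^ k * ⁅z, x⁆ ^ k) := by
        rw [← mul_assoc]
        exact Subgroup.mem_center_iff.1 (hcp z y) _
      calc x * y * ⁅y, x⁆ ^ k * z * (⁅z, x⁆ ^ k * ⁅z, y⁆ ^ k)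
          = x * y * (⁅y, x⁆ ^ k * z) * (⁅z, x⁆ ^ k * ⁅z, y⁆ ^ k) := by group
        _ = x * y * z * (⁅y, x⁆ ^ k * (⁅z, x⁆ ^ k * ⁅z, y⁆ ^ k)) := by rw [h1]; group
        _ = _ := by rw [h2]; group
    zero_add := fun x => by simp [hadd, hzero]
    add_zero := fun x => by simp [hadd, hzero]
    neg_add_cancel := fun x => by
      have h : ⁅x, x⁻¹⁆ = 1 := by simp [commutatorElement_def]
      simp [hadd, hzero, hneg, h]
    add_comm := fun x y => by
      simp only [hadd]
      have h : y * x = x * y * ⁅y, x⁆ := by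
        rw [Subgroup.mem_center_iff.1 (hc y x), commutatorElement_def]; group
      rw [h, mul_assoc (x * y)]
      congr 1
      rw [← commutatorElement_inv y x, inv_pow, eq_mul_inv_iff_mul_eq, ← pow_add, hk] }

/-- Let `p` be an odd prime and `G` a group of class at most two, of order at most `p ^ p` a power
of `p`, with center of order `p`. Then every automorphism of `G` of `p`-power order has order
dividing `p`. -/
theorem MulAut.pow_prime_eq_one_of_card_center [Finite G] {p m j : ℕ} (hp : p.Prime)
    (hp2 : p ≠ 2) (hmp : m ≤ p) (hc : ∀ x y : G, ⁅x, y⁆ ∈ Subgroup.center G)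
    (hcard : Nat.card G = p ^ m) (hZ : Nat.card (Subgroup.center G) = p)
    (α : MulAut G) (hα : α ^ p ^ j = 1) : α ^ p = 1 := by
  have hcpow (x y : G) : ⁅x, y⁆ ^ p = 1 := by
    have h := pow_card_eq_one' (x := (⟨⁅x, y⁆, hc x y⟩ : Subgroup.center G))
    rw [hZ] at h
    exact congrArg Subtype.val h
  obtain ⟨k, hk⟩ := hp.odd_of_ne_two hp2
  have hk' (x y : G) : ⁅x, y⁆ ^ ((k + 1) + (k + 1)) = ⁅x, y⁆ := by
    rw [show k + 1 + (k + 1) = p + 1 by lia, pow_succ, hcpow, one_mul]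
  let _ := baerAddCommGroup (k + 1) hc hk'
  have hadd (x y : G) : x + y = x * y * ⁅y, x⁆ ^ (k + 1) := rfl
  have hzero : (0 : G) = 1 := rfl
  have hsmul (i : ℕ) (x : G) : i • x = x ^ i := by
    induction i with
    | zero => rw [zero_smul, pow_zero, hzero]
    | succ i ih =>
      have h : ⁅x, x ^ i⁆ = 1 :=
        commutatorElement_eq_one_iff_commute.2 (Commute.self_pow x i)
      rw [succ_nsmul, ih, hadd, h, one_pow, mul_one, pow_succ]
  let F : MulAut G → AddMonoid.End G := fun β =>
    { toFun := β
      map_zero' := map_one β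
      map_add' := fun x y => by simp [hadd, map_commutatorElement] }
  have hF (i : ℕ) (x : G) : (F α ^ i) x = (α ^ i) x := by
    induction i generalizing x with
    | zero => rfl
    | succ i ih => rw [pow_succ, pow_succ]; exact ih (α x)
  obtain ⟨A, hA⟩ : ∃ A : AddMonoid.End G, F α = 1 + A := ⟨F α - 1, by abel⟩
  have hApply (x : G) : A x = α x - x := by
    have h : α x = x + A x := congrArg (fun f : AddMonoid.End G => f x) hA
    rw [h]; abel
  have hnil : IsNilpotent A := by
    refine isNilpotent_of_one_add_pow_prime_pow_eq_one hp (k := j) ⟨m, ?_⟩ ?_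
    · ext x
      rw [← Nat.cast_pow, ← hcard]
      change Nat.card G • x = 0
      exact card_nsmul_eq_zero'
    · rw [← hA]
      ext x
      rw [hF, hα]
      rfl
  let Z : AddSubgroup G :=
    { carrier := Subgroup.center G
      add_mem' := fun {x y} hx hy => mul_mem (mul_mem hx hy) (pow_mem (hc y x) _)
      zero_mem' := one_mem _
      neg_mem' := fun {x} hx => inv_mem hx }
  have hAZ : ∀ x ∈ Z, A x = 0 := by
    have h := Z.nilpotent_end_pow_apply_eq_zero hp hnil 1 (by rw [pow_one]; exact hZ)
      (fun x hx => by
        rw [hApply]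
        refine sub_mem (?_ : α x ∈ Subgroup.center G) hx
        rw [← Subgroup.characteristic_iff_map_eq.1 Subgroup.centerCharacteristic α]
        exact ⟨x, hx, rfl⟩)
    simpa using h
  have hpA : (p : AddMonoid.End G) * A = 0 := by
    ext x
    have hx : p • x ∈ Z := by
      rw [hsmul]
      refine Subgroup.mem_center_iff.2 fun y => ?_
      refine (commutatorElement_eq_one_iff_mul_comm.1 ?_).symm
      rw [commutatorElement_pow_left_of_mem_center hc, hcpow]
    change p • A x = 0
    rw [← map_nsmul, hAZ _ hx]
  have hAp : A ^ p = 0 := by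
    refine pow_eq_zero_of_le hmp ?_
    ext x
    exact (⊤ : AddSubgroup G).nilpotent_end_pow_apply_eq_zero hp hnil m
      (by rw [AddSubgroup.card_top, hcard]) (fun _ _ => trivial) x trivial
  ext x
  rw [← hF, hA, one_add_pow_prime_eq_one hp hpA hAp]
  rfl

end ClassTwo

theorem extraspecial_no_automorphism_of_order_pPow (p n : ℕ) (hp : p.Prime)
    (hn : 1 < n) (hpn : 2 * n < p) (G : Type*) [Group G] [Finite G]
    (hG : IsExtraspecial p G) (hcard : Nat.card G = p ^ (2 * n + 1)) :
    ¬ ∃ α : MulAut G, orderOf α = p ^ n := by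
  rintro ⟨α, hα⟩
  obtain ⟨-, hcomm, -, hZ⟩ := hG
  have hc (x y : G) : ⁅x, y⁆ ∈ Subgroup.center G := by
    rw [hcomm]
    exact Subgroup.commutator_mem_commutator (Subgroup.mem_top x) (Subgroup.mem_top y)
  have h := MulAut.pow_prime_eq_one_of_card_center hp (by lia) hpn hc hcard hZ α
    (hα ▸ pow_orderOf_eq_one α)
  have hdvd := orderOf_dvd_of_pow_eq_one h
  rw [hα] at hdvd
  have hle := Nat.le_of_dvd hp.pos hdvd
  have hlt := Nat.pow_lt_pow_right hp.one_lt hn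
  lia
end

section
/- Let p be a prime and let n be a positive integer with n ≤ p. Then every element A of the general linear group GL(n, 𝔽_p) over the field with p elements whose order is a power of p satisfies A^p = 1. (Equivalently, the Sylow p-subgroups of GL(n, p) have exponent p when p ≥ n.) -/
theorem GL_pPowOrder_elt_pow_p_eq_one (p n : ℕ) (hp : p.Prime) (hn : 0 < n)
    (hnp : n ≤ p) (A : GL (Fin n) (ZMod p)) (hA : ∃ k : ℕ, orderOf A = p ^ k) :
    A ^ p = 1 := by
  have : Fact p.Prime := ⟨hp⟩
  have : Nonempty (Fin n) := ⟨⟨0, hn⟩⟩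
  obtain ⟨k, hk⟩ := hA
  have hcomm : Commute (A : Matrix (Fin n) (Fin n) (ZMod p)) 1 := Commute.one_right _
  set N : Matrix (Fin n) (Fin n) (ZMod p) := A - 1 with hN
  have hnil : IsNilpotent N := by
    refine ⟨p ^ k, ?_⟩
    rw [hN, sub_pow_char_pow_of_commute (p := p) k hcomm, one_pow, ← Units.val_pow_eq_pow_val, ← hk,
      pow_orderOf_eq_one, Units.val_one, sub_self]
  have hchar : N.charpoly = Polynomial.X ^ n := by
    have h := Matrix.isNilpotent_charpoly_sub_pow_of_isNilpotent hnil
    simpa [sub_eq_zero] using h.eq_zero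
  have hpow : N ^ n = 0 := by
    simpa [hchar] using N.aeval_self_charpoly
  have hNp : N ^ p = 0 := pow_eq_zero_of_le hnp hpow
  rw [hN, sub_pow_char_of_commute p hcomm, one_pow, sub_eq_zero] at hNp
  exact Units.ext (by simpa using hNp)
end

section
/- Let p be an odd prime and let n ≥ 3 be an integer. Then there exists a finite group P of order p^(2n+2) such that P has derived length exactly 3 (P'' ≠ 1 and P''' = 1) and P has a normal subgroup G of index p which is an extraspecial p-group of order p^(2n+1) and exponent p. -/
/-- The set of character degrees of `G`: the dimensions of the simple
finite-dimensional complex representations of `G`. -/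
def charDegrees (G : Type) [Group G] : Set ℕ :=
  {d | ∃ V : FDRep ℂ G, CategoryTheory.Simple V ∧ Module.finrank ℂ V = d}

open Matrix
open scoped commutatorElement

/-- If the center of a group coincides with its derived subgroup, it is contained in every maximal
subgroup. -/
theorem center_le_frattini_of_center_eq_commutator {G : Type*} [Group G]
    (h : Subgroup.center G = commutator G) : Subgroup.center G ≤ frattini G := by
  refine le_iInf₂ fun M hM => ?_
  by_contra hnot
  have hsup : M ⊔ Subgroup.center G = ⊤ := hM.2 _ (left_lt_sup.mpr hnot)
  have hdecomp (g : G) : ∃ m ∈ M, ∃ z ∈ Subgroup.center G, m * z = g :=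
    Subgroup.mem_sup_of_normal_right.mp (hsup ▸ Subgroup.mem_top g)
  refine hnot (h ▸ ?_)
  rw [commutator_def, Subgroup.commutator_le]
  intro a _ b _
  obtain ⟨m, hm, z, hz, rfl⟩ := hdecomp a
  obtain ⟨k, hk, w, hw, rfl⟩ := hdecomp b
  have hz' := Subgroup.mem_center_iff.mp hz
  have hw' := Subgroup.mem_center_iff.mp hw
  have key : ⁅m * z, k * w⁆ = ⁅m, k⁆ := by
    calc ⁅m * z, k * w⁆ = m * (z * (k * w)) * z⁻¹ * m⁻¹ * (w⁻¹ * k⁻¹) := by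
          simp only [commutatorElement_def, _root_.mul_inv_rev, mul_assoc]
      _ = m * k * (w * m⁻¹) * w⁻¹ * k⁻¹ := by
          rw [← hz' (k * w)]; simp only [mul_assoc, mul_inv_cancel_left]
      _ = ⁅m, k⁆ := by
          rw [← hw' m⁻¹]; simp only [commutatorElement_def, mul_assoc, mul_inv_cancel_left]
  rw [key, commutatorElement_def]
  exact M.mul_mem (M.mul_mem (M.mul_mem hm hk) (M.inv_mem hm)) (M.inv_mem hk)

theorem frattini_eq_bot_of_isSimpleOrder {G : Type*} [Group G] [IsSimpleOrder (Subgroup G)] :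
    frattini G = ⊥ :=
  le_bot_iff.mp (frattini_le_coatom isCoatom_bot)

theorem IsExtraspecial.of_mulEquiv {p : ℕ} {G H : Type*} [Group G] [Group H] (e : G ≃* H)
    (hG : IsExtraspecial p G) : IsExtraspecial p H := by
  obtain ⟨hp, hc, hf, hcard⟩ := hG
  have hcomm : (commutator G).map e.toMonoidHom = commutator H := by
    rw [commutator_def, commutator_def, Subgroup.map_commutator,
      Subgroup.map_top_of_surjective _ e.surjective]
  have hcenter : (Subgroup.center G).map e.toMonoidHom = Subgroup.center H := by
    ext x
    rw [Subgroup.mem_map_equiv, Subgroup.mem_center_iff, Subgroup.mem_center_iff,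
      ← e.forall_congr_right]
    refine forall_congr' fun g => ?_
    rw [← e.injective.eq_iff]
    simp
  have hfrat : (frattini G).map e.toMonoidHom = frattini H := e.mapSubgroup.map_radical
  refine ⟨hp.of_equiv e, ?_, ?_, ?_⟩
  · rw [← hcenter, hc, hcomm]
  · rw [← hcomm, hf, hfrat]
  · rw [← hcard]
    exact (Nat.card_congr (Subgroup.centerCongr e).toEquiv).symm

/-- The Heisenberg group over `R` with coordinates indexed by `ι`. -/
@[ext]
structure HeisenbergGroup (ι R : Type*) where
  /-- The first vector coordinate. -/
  x : ι → R
  /-- The second vector coordinate. -/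
  y : ι → R
  /-- The central coordinate. -/
  z : R

namespace HeisenbergGroup

variable {ι R : Type*}

/-- The underlying type of the Heisenberg group is a product. -/
def equivProd : HeisenbergGroup ι R ≃ (ι → R) × (ι → R) × R where
  toFun a := (a.x, a.y, a.z)
  invFun a := ⟨a.1, a.2.1, a.2.2⟩
  left_inv _ := rfl
  right_inv _ := rfl

instance [Finite ι] [Finite R] : Finite (HeisenbergGroup ι R) :=
  Finite.of_equiv _ equivProd.symm

theorem natCard [Fintype ι] :
    Nat.card (HeisenbergGroup ι R) = Nat.card R ^ (2 * Fintype.card ι + 1) := by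
  rw [Nat.card_congr equivProd, Nat.card_prod, Nat.card_prod, Nat.card_fun]
  simp only [Nat.card_eq_fintype_card (α := ι)]
  ring

variable [CommRing R]

instance : One (HeisenbergGroup ι R) := ⟨⟨0, 0, 0⟩⟩

@[simp] theorem one_x : (1 : HeisenbergGroup ι R).x = 0 := rfl
@[simp] theorem one_y : (1 : HeisenbergGroup ι R).y = 0 := rfl
@[simp] theorem one_z : (1 : HeisenbergGroup ι R).z = 0 := rfl

variable [Fintype ι]

instance : Mul (HeisenbergGroup ι R) := ⟨fun a b => ⟨a.x + b.x, a.y + b.y, a.z + b.z + a.x ⬝ᵥ b.y⟩⟩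
instance : Inv (HeisenbergGroup ι R) := ⟨fun a => ⟨-a.x, -a.y, -a.z + a.x ⬝ᵥ a.y⟩⟩

@[simp] theorem mul_x (a b : HeisenbergGroup ι R) : (a * b).x = a.x + b.x := rfl
@[simp] theorem mul_y (a b : HeisenbergGroup ι R) : (a * b).y = a.y + b.y := rfl
@[simp] theorem mul_z (a b : HeisenbergGroup ι R) : (a * b).z = a.z + b.z + a.x ⬝ᵥ b.y := rfl
@[simp] theorem inv_x (a : HeisenbergGroup ι R) : a⁻¹.x = -a.x := rfl
@[simp] theorem inv_y (a : HeisenbergGroup ι R) : a⁻¹.y = -a.y := rfl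
@[simp] theorem inv_z (a : HeisenbergGroup ι R) : a⁻¹.z = -a.z + a.x ⬝ᵥ a.y := rfl

instance : Group (HeisenbergGroup ι R) :=
  Group.ofLeftAxioms
    (fun a b c => by
      ext1
      · simp [add_assoc]
      · simp [add_assoc]
      · simp only [mul_x, mul_y, mul_z, add_dotProduct, dotProduct_add]
        ring)
    (fun a => by ext1 <;> simp)
    (fun a => by ext1 <;> simp)

theorem commutatorElement_eq (a b : HeisenbergGroup ι R) :
    ⁅a, b⁆ = ⟨0, 0, a.x ⬝ᵥ b.y - b.x ⬝ᵥ a.y⟩ := by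
  rw [commutatorElement_def]
  ext1
  · simp
  · simp
  · simp only [mul_x, mul_z, inv_x, inv_y, inv_z, add_dotProduct, dotProduct_neg,
      neg_dotProduct]
    ring

theorem pow_eq (a : HeisenbergGroup ι R) (k : ℕ) :
    a ^ k = ⟨k • a.x, k • a.y, k • a.z + k.choose 2 • (a.x ⬝ᵥ a.y)⟩ := by
  induction k with
  | zero => ext1 <;> simp
  | succ k ih =>
    rw [pow_succ, ih]
    ext1
    · simp [add_mul]
    · simp [add_mul]
    · simp only [mul_z, Nat.choose_succ_succ' k 1, Nat.choose_one_right, add_smul, one_smul,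
        smul_dotProduct]
      abel

theorem pow_char_eq_one {p : ℕ} [CharP R p] (hodd : Odd p) (a : HeisenbergGroup ι R) :
    a ^ p = 1 := by
  have hchoose : p ∣ p.choose 2 := by
    obtain ⟨k, rfl⟩ := hodd
    refine ⟨k, ?_⟩
    rw [Nat.choose_two_right, Nat.add_sub_cancel, mul_left_comm, Nat.mul_div_cancel_left _ two_pos]
  rw [pow_eq]
  ext1
  · ext i; simp
  · ext i; simp
  · simp [(CharP.cast_eq_zero_iff R p _).mpr hchoose]

theorem mem_center_iff {a : HeisenbergGroup ι R} :
    a ∈ Subgroup.center (HeisenbergGroup ι R) ↔ a.x = 0 ∧ a.y = 0 := by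
  classical
  have hcomm (b : HeisenbergGroup ι R) : b * a = a * b ↔ b.x ⬝ᵥ a.y = a.x ⬝ᵥ b.y := by
    simp [HeisenbergGroup.ext_iff, add_comm]
  simp only [Subgroup.mem_center_iff, hcomm]
  refine ⟨fun h => ⟨?_, ?_⟩, ?_⟩
  · ext i
    simpa using (h ⟨0, Pi.single i 1, 0⟩).symm
  · ext i
    simpa using h ⟨Pi.single i 1, 0, 0⟩
  · rintro ⟨hx, hy⟩ b
    simp [hx, hy]

theorem center_eq_commutator [Nonempty ι] :
    Subgroup.center (HeisenbergGroup ι R) = commutator (HeisenbergGroup ι R) := by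
  classical
  apply le_antisymm
  · intro a ha
    obtain ⟨hx, hy⟩ := mem_center_iff.mp ha
    obtain ⟨i⟩ := ‹Nonempty ι›
    have key : ⁅(⟨Pi.single i a.z, 0, 0⟩ : HeisenbergGroup ι R), ⟨0, Pi.single i 1, 0⟩⁆ = a := by
      rw [commutatorElement_eq]
      ext1 <;> simp [hx, hy]
    rw [← key]
    exact Subgroup.commutator_mem_commutator (Subgroup.mem_top _) (Subgroup.mem_top _)
  · rw [commutator_def, Subgroup.commutator_le]
    intro a _ b _
    simp [commutatorElement_eq, mem_center_iff]

theorem natCard_center : Nat.card (Subgroup.center (HeisenbergGroup ι R)) = Nat.card R :=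
  Nat.card_congr
    { toFun := fun a => a.1.z
      invFun := fun z => ⟨⟨0, 0, z⟩, mem_center_iff.mpr ⟨rfl, rfl⟩⟩
      left_inv := fun a => by
        obtain ⟨hx, hy⟩ := mem_center_iff.mp a.2
        ext1
        ext1 <;> simp [hx, hy]
      right_inv := fun _ => rfl }

/-- The `i`-th entry of the first vector coordinate, as a homomorphism. -/
def xHom (i : ι) : HeisenbergGroup ι R →* Multiplicative R where
  toFun a := .ofAdd (a.x i)
  map_one' := rfl
  map_mul' _ _ := rfl

/-- The `i`-th entry of the second vector coordinate, as a homomorphism. -/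
def yHom (i : ι) : HeisenbergGroup ι R →* Multiplicative R where
  toFun a := .ofAdd (a.y i)
  map_one' := rfl
  map_mul' _ _ := rfl

theorem frattini_le_center {p : ℕ} [Fact p.Prime] :
    frattini (HeisenbergGroup ι (ZMod p)) ≤ Subgroup.center (HeisenbergGroup ι (ZMod p)) := by
  have : IsSimpleGroup (Multiplicative (ZMod p)) :=
    isSimpleGroup_of_prime_card ((Nat.card_congr Multiplicative.toAdd).trans (Nat.card_zmod p))
  have hker (f : HeisenbergGroup ι (ZMod p) →* Multiplicative (ZMod p))
      (hf : Function.Surjective f) {a} (ha : a ∈ frattini (HeisenbergGroup ι (ZMod p))) :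
      f a = 1 := by
    simpa [frattini_eq_bot_of_isSimpleOrder] using frattini_le_comap_frattini_of_surjective hf ha
  intro a ha
  refine mem_center_iff.mpr ⟨?_, ?_⟩
  · ext i
    exact hker (xHom i) (fun r => ⟨⟨fun _ => r.toAdd, 0, 0⟩, rfl⟩) ha
  · ext i
    exact hker (yHom i) (fun r => ⟨⟨0, fun _ => r.toAdd, 0⟩, rfl⟩) ha

theorem isExtraspecial {p : ℕ} [Fact p.Prime] [Nonempty ι] :
    IsExtraspecial p (HeisenbergGroup ι (ZMod p)) := by
  refine ⟨IsPGroup.of_card (by rw [natCard, Nat.card_zmod]), center_eq_commutator, ?_, ?_⟩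
  · rw [← center_eq_commutator]
    exact (center_le_frattini_of_center_eq_commutator center_eq_commutator).antisymm
      frattini_le_center
  · rw [natCard_center, Nat.card_zmod]

variable [DecidableEq ι]

/-- The action of an invertible matrix on the Heisenberg group: the matrix acts on the first vector
coordinate and its inverse transpose on the second one. -/
def matrixAut : (Matrix ι ι R)ˣ →* MulAut (HeisenbergGroup ι R) where
  toFun M :=
    { toFun := fun a => ⟨M.1 *ᵥ a.x, a.y ᵥ* M⁻¹.1, a.z⟩
      invFun := fun a => ⟨M⁻¹.1 *ᵥ a.x, a.y ᵥ* M.1, a.z⟩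
      left_inv := fun a => by ext1 <;> simp
      right_inv := fun a => by ext1 <;> simp
      map_mul' := fun a b => by
        ext1
        · simp [mulVec_add]
        · simp [add_vecMul]
        · simp [dotProduct_comm (M.1 *ᵥ a.x), dotProduct_mulVec, dotProduct_comm b.y] }
  map_one' := by ext a : 2 <;> simp
  map_mul' M N := by ext a : 2 <;> simp

end HeisenbergGroup

/-- The one-parameter group of unipotent matrices with a single nontrivial Jordan block of
size three. -/
def unipotentMatrix (κ R : Type*) [Fintype κ] [DecidableEq κ] [CommRing R] :
    Multiplicative R →* Matrix (Fin 3 ⊕ κ) (Fin 3 ⊕ κ) R where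
  toFun t := fromBlocks !![1, t.toAdd, t.toAdd ^ 2; 0, 1, 2 * t.toAdd; 0, 0, 1] 0 0 1
  map_one' := by
    rw [← fromBlocks_one]
    congr 1
    ext i j
    fin_cases i <;> fin_cases j <;> simp
  map_mul' s t := by
    rw [fromBlocks_multiply]
    simp only [Matrix.mul_zero, Matrix.zero_mul, Matrix.mul_one, add_zero, zero_add]
    congr 1
    ext i j
    fin_cases i <;> fin_cases j <;> simp [Matrix.mul_apply, Fin.sum_univ_three] <;> ring

/-- The action of the additive group of `R` on the Heisenberg group through unipotent matrices. -/
def unipotentAction (κ R : Type*) [Fintype κ] [DecidableEq κ] [CommRing R] :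
    Multiplicative R →* MulAut (HeisenbergGroup (Fin 3 ⊕ κ) R) :=
  HeisenbergGroup.matrixAut.comp (unipotentMatrix κ R).toHomUnits

theorem unipotentAction_apply {κ R : Type*} [Fintype κ] [DecidableEq κ] [CommRing R]
    (t : Multiplicative R) (a : HeisenbergGroup (Fin 3 ⊕ κ) R) :
    unipotentAction κ R t a =
      ⟨unipotentMatrix κ R t *ᵥ a.x, a.y ᵥ* unipotentMatrix κ R t⁻¹, a.z⟩ :=
  rfl

theorem derivedSeries_two_semidirectProduct_ne_bot {κ R : Type*} [Fintype κ] [DecidableEq κ]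
    [CommRing R] (h2 : (2 : R) ≠ 0) :
    derivedSeries (HeisenbergGroup (Fin 3 ⊕ κ) R ⋊[unipotentAction κ R] Multiplicative R) 2 ≠ ⊥ := by
  let φ := unipotentAction κ R
  have hmem (t : Multiplicative R) (a : HeisenbergGroup (Fin 3 ⊕ κ) R) :
      SemidirectProduct.inl (φ := φ) (φ t a * a⁻¹) ∈
        derivedSeries (HeisenbergGroup (Fin 3 ⊕ κ) R ⋊[φ] Multiplicative R) 1 := by
    rw [map_mul, SemidirectProduct.inl_aut, map_inv, map_inv]
    exact Subgroup.commutator_mem_commutator (Subgroup.mem_top _) (Subgroup.mem_top _)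
  have hne := Subgroup.commutator_mem_commutator
    (hmem (.ofAdd 1) ⟨Pi.single (Sum.inl 2) 1, 0, 0⟩)
    (hmem (.ofAdd 1) ⟨0, Pi.single (Sum.inl 0) 1, 0⟩)
  intro hbot
  rw [← map_commutatorElement, ← derivedSeries_succ, hbot, Subgroup.mem_bot,
    map_eq_one_iff _ SemidirectProduct.inl_injective, HeisenbergGroup.commutatorElement_eq] at hne
  apply h2
  have := congrArg HeisenbergGroup.z hne
  simpa [φ, unipotentAction_apply, unipotentMatrix, dotProduct, Fin.sum_univ_three,
    Pi.single_apply] using this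

theorem derivedSeries_three_semidirectProduct_eq_bot {N A : Type*} [Group N] [CommGroup A]
    (φ : A →* MulAut N) (hN : commutator N ≤ Subgroup.center N) :
    derivedSeries (N ⋊[φ] A) 3 = ⊥ := by
  have h1 : derivedSeries (N ⋊[φ] A) 1 ≤ (⊤ : Subgroup N).map SemidirectProduct.inl := by
    rw [← MonoidHom.range_eq_map, SemidirectProduct.range_inl_eq_ker_rightHom, derivedSeries_one]
    exact Abelianization.commutator_subset_ker _
  have h2 : derivedSeries (N ⋊[φ] A) 2 ≤ (Subgroup.center N).map SemidirectProduct.inl :=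
    (Subgroup.commutator_le_map_commutator h1 h1).trans (Subgroup.map_mono hN)
  refine le_bot_iff.mp ((Subgroup.commutator_le_map_commutator h2 h2).trans ?_)
  rw [Subgroup.commutator_eq_bot_iff_le_centralizer.mpr, Subgroup.map_bot]
  exact Subgroup.center_le_centralizer _

theorem exists_group_dl_three_with_extraspecial_subgroup (p n : ℕ)
    (hp : p.Prime) (hodd : Odd p) (hn : 3 ≤ n) :
    ∃ (P : Type) (_ : Group P) (_ : Finite P),
      Nat.card P = p ^ (2 * n + 2) ∧
      derivedSeries P 2 ≠ ⊥ ∧ derivedSeries P 3 = ⊥ ∧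
      ∃ G : Subgroup P, G.Normal ∧ G.index = p ∧
        IsExtraspecial p ↥G ∧ Nat.card ↥G = p ^ (2 * n + 1) ∧
        ∀ g ∈ G, g ^ p = 1 := by
  obtain ⟨m, rfl⟩ := Nat.exists_eq_add_of_le hn
  have : Fact p.Prime := ⟨hp⟩
  let N := HeisenbergGroup (Fin 3 ⊕ Fin m) (ZMod p)
  let φ : Multiplicative (ZMod p) →* MulAut N := unipotentAction (Fin m) (ZMod p)
  have hcardN : Nat.card N = p ^ (2 * (3 + m) + 1) := by
    simp [N, HeisenbergGroup.natCard]
  have hcardP : Nat.card (N ⋊[φ] Multiplicative (ZMod p)) = p ^ (2 * (3 + m) + 2) := by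
    rw [SemidirectProduct.card, hcardN, Nat.card_congr Multiplicative.toAdd, Nat.card_zmod,
      ← pow_succ]
  have h2 : (2 : ZMod p) ≠ 0 :=
    Ring.two_ne_zero (by rw [ZMod.ringChar_zmod_n]; rintro rfl; exact absurd hodd (by decide))
  let e := MonoidHom.ofInjective (SemidirectProduct.inl_injective (φ := φ))
  refine ⟨N ⋊[φ] Multiplicative (ZMod p), inferInstance,
    Nat.finite_of_card_ne_zero (hcardP ▸ (pow_pos hp.pos _).ne'), hcardP,
    derivedSeries_two_semidirectProduct_ne_bot h2,
    derivedSeries_three_semidirectProduct_eq_bot φ HeisenbergGroup.center_eq_commutator.ge,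
    SemidirectProduct.inl.range, ?_, ?_, HeisenbergGroup.isExtraspecial.of_mulEquiv e, ?_, ?_⟩
  · rw [SemidirectProduct.range_inl_eq_ker_rightHom]
    infer_instance
  · rw [SemidirectProduct.range_inl_eq_ker_rightHom, Subgroup.index_ker,
      MonoidHom.range_eq_top.mpr SemidirectProduct.rightHom_surjective, Subgroup.card_top,
      Nat.card_congr Multiplicative.toAdd, Nat.card_zmod]
  · rw [← hcardN, Nat.card_congr e.toEquiv]
  · rintro _ ⟨a, rfl⟩
    rw [← map_pow, HeisenbergGroup.pow_char_eq_one hodd, map_one]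
end

section
/- Let p be an odd prime and let n ≥ 3 be an integer. Then there exists a finite group P of order p^(2n+2) such that P has derived length exactly 3 (P'' ≠ 1 and P''' = 1) and cd(P) = {1, p, p^n}. -/
open CategoryTheory Module

section LinearAlgebra

variable {V : Type*} [AddCommGroup V] [Module ℂ V]

/-- Joint eigenvectors of a family of endomorphisms with pairwise distinct systems of eigenvalues
are linearly independent. -/
theorem linearIndependent_of_joint_eigenvectors {ι κ : Type*} (T : κ → End ℂ V) (v : ι → V)
    (χ : ι → κ → ℂ) (hv : ∀ i, v i ≠ 0) (hT : ∀ i k, T k (v i) = χ i k • v i)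
    (hχ : Function.Injective χ) : LinearIndependent ℂ v := by
  classical
  rw [linearIndependent_iff']
  intro s
  induction s using Finset.induction_on with
  | empty => simp
  | insert a s ha ih =>
    intro c hc
    rw [Finset.sum_insert ha] at hc
    have key : ∀ i ∈ s, c i = 0 := by
      intro i hi
      have hia : χ i ≠ χ a := fun h => ha (hχ h ▸ hi)
      obtain ⟨k, hk⟩ := Function.ne_iff.mp hia
      have h1 := congrArg (T k) hc
      have h2 := congrArg (χ a k • ·) hc
      simp only [map_add, map_sum, map_smul, hT, map_zero] at h1
      simp only [smul_add, Finset.smul_sum, smul_zero] at h2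
      have h3 : ∑ j ∈ s, (c j * (χ j k - χ a k)) • v j = 0 := by
        have : ∑ j ∈ s, (c j * (χ j k - χ a k)) • v j
            = (c a • χ a k • v a + ∑ j ∈ s, c j • χ j k • v j)
              - (χ a k • c a • v a + ∑ j ∈ s, χ a k • c j • v j) := by
          rw [smul_comm (χ a k) (c a), add_sub_add_left_eq_sub, ← Finset.sum_sub_distrib]
          refine Finset.sum_congr rfl fun j _ => ?_
          module
        rw [this, h1, h2, sub_zero]
      exact (mul_eq_zero.mp (ih _ h3 i hi)).resolve_right (sub_ne_zero.mpr hk)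
    have hs : ∑ i ∈ s, c i • v i = 0 := Finset.sum_eq_zero fun i hi => by rw [key i hi, zero_smul]
    rw [hs, add_zero] at hc
    intro i hi
    rcases Finset.mem_insert.mp hi with rfl | hi
    · exact (smul_eq_zero.mp hc).resolve_right (hv _)
    · exact key i hi

variable [FiniteDimensional ℂ V]

/-- An endomorphism has an eigenvector in every nonzero invariant subspace. -/
theorem exists_eigenvector_mem (T : End ℂ V) (U : Submodule ℂ V) (hU : U ≠ ⊥)
    (hT : ∀ u ∈ U, T u ∈ U) : ∃ u ∈ U, u ≠ 0 ∧ ∃ μ : ℂ, T u = μ • u := by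
  have : Nontrivial U := Submodule.nontrivial_iff_ne_bot.mpr hU
  obtain ⟨μ, hμ⟩ := End.exists_eigenvalue (T.restrict hT)
  obtain ⟨u, hu⟩ := hμ.exists_hasEigenvector
  exact ⟨u, u.2, by simpa using hu.2, μ, congrArg Subtype.val hu.apply_eq_smul⟩

/-- Pairwise commuting endomorphisms have a joint eigenvector. -/
theorem exists_joint_eigenvector [Nontrivial V] {κ : Type*} (T : κ → End ℂ V)
    (hT : ∀ i j, Commute (T i) (T j)) : ∃ v ≠ 0, ∀ k, ∃ μ : ℂ, T k v = μ • v := by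
  obtain ⟨U, ⟨hU, hinv⟩, hmin⟩ := (wellFounded_lt (α := Submodule ℂ V)).has_min
    {U | U ≠ ⊥ ∧ ∀ k, ∀ u ∈ U, T k u ∈ U} ⟨⊤, top_ne_bot, by simp⟩
  obtain ⟨v, hvU, hv⟩ := U.exists_mem_ne_zero_of_ne_bot hU
  refine ⟨v, hv, fun k => ?_⟩
  obtain ⟨u, huU, hu, μ, hμ⟩ := exists_eigenvector_mem (T k) U hU (hinv k)
  have hle : U ⊓ End.eigenspace (T k) μ = U := by
    by_contra h
    refine hmin _ ⟨?_, ?_⟩ (lt_of_le_of_ne inf_le_left h)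
    · exact fun hb => hu ((Submodule.mem_bot ℂ).mp (hb ▸ ⟨huU, End.mem_eigenspace_iff.mpr hμ⟩))
    · rintro j x ⟨hx, hx'⟩
      refine ⟨hinv j x hx, End.mem_eigenspace_iff.mpr ?_⟩
      have := LinearMap.congr_fun (hT k j).eq x
      simp only [End.mul_apply] at this
      rw [this, End.mem_eigenspace_iff.mp hx', map_smul]
  exact ⟨μ, End.mem_eigenspace_iff.mp (hle.ge hvU).2⟩

end LinearAlgebra

namespace Representation

variable {G : Type*} [Group G] {V : Type*} [AddCommGroup V] [Module ℂ V]
  (ρ : Representation ℂ G V)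

theorem IsIrreducible.eq_top_of_invariant {ρ : Representation ℂ G V} (hρ : ρ.IsIrreducible)
    (U : Submodule ℂ V) (hU : U ≠ ⊥) (hinv : ∀ g, ∀ u ∈ U, ρ g u ∈ U) : U = ⊤ := by
  rcases hρ.eq_bot_or_eq_top ⟨U, fun g u hu => hinv g u hu⟩ with h | h
  · exact absurd (congrArg Subrepresentation.toSubmodule h) hU
  · exact congrArg Subrepresentation.toSubmodule h

theorem IsIrreducible.nontrivial {ρ : Representation ℂ G V} (hρ : ρ.IsIrreducible) :
    Nontrivial V := by
  by_contra h
  rw [not_nontrivial_iff_subsingleton] at h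
  exact bot_ne_top (α := Subrepresentation ρ)
    (Subrepresentation.toSubmodule_injective (Subsingleton.elim _ _))

/-- If the orbit of a nonzero vector `v` under an irreducible representation consists of multiples
of the vectors `ρ (t i) v`, and these are joint eigenvectors of some group elements with pairwise
distinct systems of eigenvalues, then they form a basis. -/
theorem IsIrreducible.finrank_eq_card {ρ : Representation ℂ G V} (hρ : ρ.IsIrreducible)
    {ι κ : Type*} [Finite ι] (t : ι → G) (a : κ → G) (χ : ι → κ → ℂ) {v : V} (hv : v ≠ 0)
    (hspan : ∀ g, ∃ i, ∃ c : ℂ, ρ g v = c • ρ (t i) v)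
    (heig : ∀ i k, ρ (a k) (ρ (t i) v) = χ i k • ρ (t i) v)
    (hχ : Function.Injective χ) : finrank ℂ V = Nat.card ι := by
  have := Fintype.ofFinite ι
  have hne : ∀ g, ρ g v ≠ 0 := fun g h => hv <| by
    simpa using congrArg (ρ g⁻¹) h
  have hli : LinearIndependent ℂ fun i => ρ (t i) v :=
    linearIndependent_of_joint_eigenvectors (fun k => ρ (a k)) _ χ (fun i => hne _) heig hχ
  have hmem : ∀ g, ρ g v ∈ Submodule.span ℂ (Set.range fun i => ρ (t i) v) := fun g => by
    obtain ⟨i, c, h⟩ := hspan g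
    exact h ▸ Submodule.smul_mem _ _ (Submodule.subset_span ⟨i, rfl⟩)
  have htop : Submodule.span ℂ (Set.range fun i => ρ (t i) v) = ⊤ := by
    refine hρ.eq_top_of_invariant _ (fun h => hv ?_) fun g u hu => ?_
    · simpa [h] using hmem 1
    · induction hu using Submodule.span_induction with
      | mem x hx =>
        obtain ⟨i, rfl⟩ := hx
        simpa using hmem (g * t i)
      | zero => simp
      | add x y _ _ hx hy => rw [map_add]; exact add_mem hx hy
      | smul c x _ hx => rw [map_smul]; exact Submodule.smul_mem _ _ hx
  rw [finrank_eq_card_basis (Basis.mk hli htop.ge), Nat.card_eq_fintype_card]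

/-- Schur's lemma for central elements. -/
theorem IsIrreducible.exists_scalar_of_central [FiniteDimensional ℂ V]
    {ρ : Representation ℂ G V} (hρ : ρ.IsIrreducible)
    {z : G} (hz : ∀ g, Commute z g) : ∃ μ : ℂ, ∀ v, ρ z v = μ • v := by
  have := hρ.nontrivial
  obtain ⟨u, -, hu, μ, hμ⟩ := exists_eigenvector_mem (ρ z) ⊤ top_ne_bot (by simp)
  have htop := hρ.eq_top_of_invariant (End.eigenspace (ρ z) μ)
    (fun h => hu ((Submodule.mem_bot ℂ).mp (h ▸ End.mem_eigenspace_iff.mpr hμ)))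
    (fun g u hu => by
      rw [End.mem_eigenspace_iff] at hu ⊢
      rw [← End.mul_apply, ← map_mul, (hz g).eq, map_mul, End.mul_apply, hu, map_smul])
  exact ⟨μ, fun v => End.mem_eigenspace_iff.mp (htop ▸ Submodule.mem_top)⟩

/-- The derived subgroup acts trivially in every one-dimensional representation. -/
theorem apply_eq_one_of_finrank_eq_one (h : finrank ℂ V = 1) {g : G} (hg : g ∈ derivedSeries G 1) :
    ρ g = 1 := by
  have hcomm : ∀ S T : End ℂ V, S * T = T * S := fun S T => by
    obtain ⟨a, rfl, -⟩ := LinearMap.existsUnique_eq_smul_id_of_finrank_eq_one h S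
    obtain ⟨b, rfl, -⟩ := LinearMap.existsUnique_eq_smul_id_of_finrank_eq_one h T
    ext v
    simp [smul_comm a b]
  have hle : derivedSeries G 1 ≤ ρ.ker := by
    rw [derivedSeries_succ, Subgroup.commutator_le]
    intro x _ y _
    rw [MonoidHom.mem_ker, commutatorElement_def, map_mul, map_mul, map_mul, hcomm (ρ x),
      ← map_mul, ← map_mul, ← map_mul, mul_inv_cancel_right, mul_inv_cancel, map_one]
  exact hle hg

open scoped MonoidAlgebra in
theorem exists_irreducible_apply_ne_one {G : Type} [Group G] [Finite G] {g : G} (hg : g ≠ 1) :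
    ∃ (V : Type) (_ : AddCommGroup V) (_ : Module ℂ V) (_ : FiniteDimensional ℂ V)
      (ρ : Representation ℂ G V), ρ.IsIrreducible ∧ ρ g ≠ 1 := by
  by_contra! hcon
  have hfix : ∀ m : Submodule ℂ[G] ℂ[G], IsSimpleModule ℂ[G] m →
      ∀ v ∈ m, MonoidAlgebra.single g (1 : ℂ) • v = v := by
    intro m hm v hv
    let : Module ℂ[G] (RestrictScalars ℂ ℂ[G] m) := RestrictScalars.moduleOrig ℂ ℂ[G] m
    have : Module.Finite ℂ[G] (RestrictScalars ℂ ℂ[G] m) :=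
      inferInstanceAs (Module.Finite ℂ[G] m)
    have : Module.Finite ℂ (RestrictScalars ℂ ℂ[G] m) := Module.Finite.trans ℂ[G] _
    have h : Representation.ofModule m g = 1 := hcon (RestrictScalars ℂ ℂ[G] m)
      inferInstance (RestrictScalars.module ℂ ℂ[G] m) this (Representation.ofModule m)
      ((isSimpleModule_iff_irreducible_ofModule m).mp hm)
    have h' := congrArg (fun T => T ((⟨v, hv⟩ : m) : RestrictScalars ℂ ℂ[G] m)) h
    exact congrArg Subtype.val h'
  have hall : ∀ v : ℂ[G], MonoidAlgebra.single g (1 : ℂ) • v = v := by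
    intro v
    have hv : v ∈ sSup {m : Submodule ℂ[G] ℂ[G] | IsSimpleModule ℂ[G] m} := by
      rw [IsSemisimpleModule.sSup_simples_eq_top]; trivial
    rw [sSup_eq_iSup'] at hv
    induction hv using Submodule.iSup_induction' with
    | mem m x hx => exact hfix m m.2 x hx
    | zero => simp
    | add x y _ _ hx hy => rw [smul_add, hx, hy]
  have h1 := hall 1
  rw [smul_eq_mul, mul_one, MonoidAlgebra.one_def] at h1
  exact hg (MonoidAlgebra.of_injective (R := ℂ) h1)

theorem IsIrreducible.comp_of_surjective {G H V : Type*} [Group G] [Group H] [AddCommGroup V]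
    [Module ℂ V] {ρ : Representation ℂ H V} (hρ : ρ.IsIrreducible) (φ : G →* H)
    (hφ : Function.Surjective φ) : IsIrreducible (ρ.comp φ : Representation ℂ G V) where
  exists_pair_ne := ⟨⊥, ⊤, fun h => by
    have := hρ.nontrivial
    exact bot_ne_top (congrArg Subrepresentation.toSubmodule h)⟩
  eq_bot_or_eq_top U := by
    by_cases hU : U.toSubmodule = ⊥
    · exact .inl (Subrepresentation.toSubmodule_injective hU)
    · refine .inr (Subrepresentation.toSubmodule_injective (hρ.eq_top_of_invariant _ hU ?_))
      intro h u hu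
      obtain ⟨g, rfl⟩ := hφ h
      exact U.apply_mem_toSubmodule g hu

/-- Every element outside a normal subgroup `N` acts nontrivially in some irreducible
representation that is trivial on `N`. -/
theorem exists_irreducible_of_notMem {G : Type} [Group G] [Finite G] (N : Subgroup G)
    [N.Normal] {g : G} (hg : g ∉ N) :
    ∃ (V : Type) (_ : AddCommGroup V) (_ : Module ℂ V) (_ : FiniteDimensional ℂ V)
      (ρ : Representation ℂ G V), ρ.IsIrreducible ∧ (∀ x ∈ N, ρ x = 1) ∧ ρ g ≠ 1 := by
  obtain ⟨V, i1, i2, i3, ρ, hρ, hne⟩ := exists_irreducible_apply_ne_one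
    (g := QuotientGroup.mk' N g) (by simpa using hg)
  refine ⟨V, i1, i2, i3, ρ.comp (QuotientGroup.mk' N),
    hρ.comp_of_surjective _ (QuotientGroup.mk'_surjective N), fun x hx => ?_, hne⟩
  rw [MonoidHom.comp_apply, QuotientGroup.mk'_apply, (QuotientGroup.eq_one_iff x).mpr hx, map_one]

end Representation

theorem FDRep.isIrreducible_of_simple {G : Type} [Group G] (V : FDRep ℂ G) [Simple V] :
    Representation.IsIrreducible V.ρ where
  exists_pair_ne := ⟨⊥, ⊤, fun h => id_nonzero V <| by
    have hsub : Subsingleton V := by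
      refine subsingleton_of_forall_eq 0 fun x => ?_
      have : x ∈ (⊤ : Submodule ℂ V) := trivial
      rw [← show (⊥ : Submodule ℂ V) = ⊤ from congrArg Subrepresentation.toSubmodule h] at this
      exact this
    apply Action.hom_ext
    ext x
    exact Subsingleton.elim (α := V) _ _⟩
  eq_bot_or_eq_top U := by
    let W : FDRep ℂ G := FDRep.of U.toRepresentation
    let f : W ⟶ V := FDRep.forget₂HomLinearEquiv W V (Rep.ofHom
      ⟨U.toSubmodule.subtype, fun g => by ext x; rfl⟩)
    have hf : ∀ x : U.toSubmodule, f.hom x = x.1 := fun x => rfl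
    have : Mono f := by
      constructor
      intro Z a b hab
      apply Action.hom_ext
      ext x
      have h := ConcreteCategory.congr_hom (congrArg Action.Hom.hom hab) x
      exact h
    by_cases h0 : f = 0
    · left
      refine Subrepresentation.toSubmodule_injective ((Submodule.eq_bot_iff _).mpr fun x hx => ?_)
      have h := ConcreteCategory.congr_hom (congrArg Action.Hom.hom h0) (⟨x, hx⟩ : U.toSubmodule)
      exact h
    · right
      have := isIso_of_mono_of_nonzero h0
      refine Subrepresentation.toSubmodule_injective ((Submodule.eq_top_iff').mpr fun x => ?_)
      have h := ConcreteCategory.congr_hom (congrArg Action.Hom.hom (IsIso.inv_hom_id f)) x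
      have hx : ((inv f).hom x : U.toSubmodule).1 = x := h
      exact hx ▸ ((inv f).hom x : U.toSubmodule).2

theorem FDRep.simple_of {G : Type} [Group G] [Finite G] {V : Type} [AddCommGroup V] [Module ℂ V]
    [FiniteDimensional ℂ V] (ρ : Representation ℂ G V) (hρ : ρ.IsIrreducible) :
    Simple (FDRep.of ρ) := by
  rw [FDRep.simple_iff_end_is_rank_one, ← (FDRep.forget₂HomLinearEquiv _ _).finrank_eq,
    (Rep.homLinearEquiv _ _).finrank_eq, FDRep.forget₂_ρ]
  exact Representation.IsIrreducible.finrank_intertwiningMap_self ρ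

/-- The semidirect product of the Heisenberg group of a vector space `W` with a group `C` acting
linearly on `W`. -/
@[ext]
structure HeisenbergExt (F W C : Type) [Field F] [AddCommGroup W] [Module F W] where
  /-- the translation part -/
  w : W
  /-- the dual part -/
  f : W →ₗ[F] F
  /-- the central part -/
  t : F
  /-- the part acting on the Heisenberg group -/
  c : C

namespace HeisenbergExt

variable {F W C : Type} [Field F] [AddCommGroup W] [Module F W]

/-- The underlying set of coordinates. -/
def equivProd : HeisenbergExt F W C ≃ (W × (W →ₗ[F] F)) × F × C where
  toFun x := ((x.w, x.f), x.t, x.c)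
  invFun x := ⟨x.1.1, x.1.2, x.2.1, x.2.2⟩

theorem natCard_eq [Finite F] [Module.Finite F W] :
    Nat.card (HeisenbergExt F W C) = Nat.card W ^ 2 * Nat.card F * Nat.card C := by
  have h : Nat.card (W →ₗ[F] F) = Nat.card W := by
    rw [natCard_eq_pow_finrank (K := F), natCard_eq_pow_finrank (K := F) (V := W),
      Subspace.dual_finrank_eq]
  rw [Nat.card_congr equivProd, Nat.card_prod, Nat.card_prod, Nat.card_prod, h]
  ring

variable [Group C]

instance : One (HeisenbergExt F W C) := ⟨⟨0, 0, 0, 1⟩⟩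

@[simp] theorem one_w : (1 : HeisenbergExt F W C).w = 0 := rfl
@[simp] theorem one_f : (1 : HeisenbergExt F W C).f = 0 := rfl
@[simp] theorem one_t : (1 : HeisenbergExt F W C).t = 0 := rfl
@[simp] theorem one_c : (1 : HeisenbergExt F W C).c = 1 := rfl

variable [DistribMulAction C W] [SMulCommClass C F W]

instance : Mul (HeisenbergExt F W C) :=
  ⟨fun x y => ⟨x.w + x.c • y.w, x.f + y.f ∘ₗ DistribSMul.toLinearMap F W x.c⁻¹,
    x.t + y.t + x.f (x.c • y.w), x.c * y.c⟩⟩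

instance : Inv (HeisenbergExt F W C) :=
  ⟨fun x => ⟨-(x.c⁻¹ • x.w), -(x.f ∘ₗ DistribSMul.toLinearMap F W x.c), -x.t + x.f x.w, x.c⁻¹⟩⟩

variable (x y : HeisenbergExt F W C)

@[simp] theorem mul_w : (x * y).w = x.w + x.c • y.w := rfl
@[simp] theorem mul_f : (x * y).f = x.f + y.f ∘ₗ DistribSMul.toLinearMap F W x.c⁻¹ := rfl
@[simp] theorem mul_t : (x * y).t = x.t + y.t + x.f (x.c • y.w) := rfl
@[simp] theorem mul_c : (x * y).c = x.c * y.c := rfl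
@[simp] theorem inv_w : (x⁻¹).w = -(x.c⁻¹ • x.w) := rfl
@[simp] theorem inv_f : (x⁻¹).f = -(x.f ∘ₗ DistribSMul.toLinearMap F W x.c) := rfl
@[simp] theorem inv_t : (x⁻¹).t = -x.t + x.f x.w := rfl
@[simp] theorem inv_c : (x⁻¹).c = x.c⁻¹ := rfl

instance : Group (HeisenbergExt F W C) :=
  Group.ofLeftAxioms
    (fun x y z => by
      ext1
      · simp [mul_smul, add_assoc]
      · ext v; simp [mul_smul, add_assoc]
      · simp [mul_smul]; ring
      · simp [mul_assoc])
    (fun x => by ext <;> simp)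
    (fun x => by ext <;> simp)

/-- The projection onto the acting group. -/
def proj : HeisenbergExt F W C →* C where
  toFun := c
  map_one' := rfl
  map_mul' _ _ := rfl

/-- The embedding of the acting group. -/
def ofC : C →* HeisenbergExt F W C where
  toFun c := ⟨0, 0, 0, c⟩
  map_one' := rfl
  map_mul' x y := by ext <;> simp

@[simp] theorem ofC_w (c : C) : (ofC c : HeisenbergExt F W C).w = 0 := rfl
@[simp] theorem ofC_f (c : C) : (ofC c : HeisenbergExt F W C).f = 0 := rfl
@[simp] theorem ofC_t (c : C) : (ofC c : HeisenbergExt F W C).t = 0 := rfl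
@[simp] theorem ofC_c (c : C) : (ofC c : HeisenbergExt F W C).c = c := rfl

/-- The central elements of the Heisenberg group. -/
def ofT (t : F) : HeisenbergExt F W C := ⟨0, 0, t, 1⟩

/-- The translations. -/
def ofW (w : W) : HeisenbergExt F W C := ⟨w, 0, 0, 1⟩

/-- The elements given by linear forms. -/
def ofF (f : W →ₗ[F] F) : HeisenbergExt F W C := ⟨0, f, 0, 1⟩

theorem commute_ofT (t : F) (g : HeisenbergExt F W C) : Commute (ofT t) g := by
  ext <;> simp [ofT, add_comm]

theorem ofT_add (s t : F) : (ofT (s + t) : HeisenbergExt F W C) = ofT s * ofT t := by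
  ext <;> simp [ofT]

theorem ofF_add (f g : W →ₗ[F] F) : (ofF (f + g) : HeisenbergExt F W C) = ofF f * ofF g := by
  ext <;> simp [ofF]

theorem eq_mul : x = ofW x.w * (ofT x.t * (ofF x.f * ofC x.c)) := by
  ext <;> simp [ofT, ofF, ofW]

theorem ofF_mul_ofW (f : W →ₗ[F] F) (w : W) :
    (ofF f * ofW w : HeisenbergExt F W C) = ofW w * (ofT (f w) * ofF f) := by
  ext <;> simp [ofT, ofF, ofW]

theorem ofF_mul_ofC (f : W →ₗ[F] F) (c : C) :
    (ofF f * ofC c : HeisenbergExt F W C) = ofC c * ofF (f ∘ₗ DistribSMul.toLinearMap F W c) := by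
  ext <;> simp [ofF]

/-- Elements of the Heisenberg group commute up to central elements. -/
theorem mul_eq_mul_ofT {x y : HeisenbergExt F W C} (hx : x.c = 1) (hy : y.c = 1) :
    x * y = ofT (x.f y.w - y.f x.w) * (y * x) := by
  ext <;> simp [ofT, hx, hy, add_comm]

/-- The centre of the Heisenberg group. -/
def heisenbergCenter : Subgroup (HeisenbergExt F W C) where
  carrier := {x | ∃ t, x = ofT t}
  one_mem' := ⟨0, rfl⟩
  mul_mem' := by
    rintro _ _ ⟨s, rfl⟩ ⟨t, rfl⟩
    exact ⟨s + t, (ofT_add s t).symm⟩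
  inv_mem' := by
    rintro _ ⟨s, rfl⟩
    exact ⟨-s, by ext <;> simp [ofT]⟩

instance : (heisenbergCenter : Subgroup (HeisenbergExt F W C)).Normal where
  conj_mem := by
    rintro _ ⟨t, rfl⟩ g
    exact ⟨t, by rw [← (commute_ofT t g).eq, mul_inv_cancel_right]⟩

section Derived

open scoped commutatorElement

theorem derivedSeries_one_le [IsCyclic C] : derivedSeries (HeisenbergExt F W C) 1 ≤ proj.ker := by
  let : CommGroup C := IsCyclic.commGroup
  rw [derivedSeries_one]
  exact Abelianization.commutator_subset_ker proj

theorem derivedSeries_two_le [IsCyclic C] :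
    derivedSeries (HeisenbergExt F W C) 2 ≤ heisenbergCenter := by
  rw [derivedSeries_succ, Subgroup.commutator_le]
  intro x hx y hy
  refine ⟨x.f y.w - y.f x.w, ?_⟩
  rw [commutatorElement_def, mul_eq_mul_ofT (derivedSeries_one_le hx) (derivedSeries_one_le hy)]
  group

theorem derivedSeries_three_eq_bot [IsCyclic C] :
    derivedSeries (HeisenbergExt F W C) 3 = ⊥ := by
  rw [derivedSeries_succ, Subgroup.commutator_eq_bot_iff_le_centralizer]
  intro x hx y _
  obtain ⟨t, rfl⟩ := derivedSeries_two_le hx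
  exact ((commute_ofT t y).eq).symm

theorem ofW_mem_derivedSeries_one (c : C) (w : W) :
    (ofW (c • w - w) : HeisenbergExt F W C) ∈ derivedSeries (HeisenbergExt F W C) 1 := by
  have : (ofW (c • w - w) : HeisenbergExt F W C) =
      ⁅(ofC c : HeisenbergExt F W C), ofW w⁆ := by
    ext <;> simp [commutatorElement_def, ofW, sub_eq_add_neg]
  rw [this, derivedSeries_one]
  exact Subgroup.commutator_mem_commutator trivial trivial

theorem ofF_mem_derivedSeries_one (c : C) (f : W →ₗ[F] F) :
    (ofF (f ∘ₗ DistribSMul.toLinearMap F W c⁻¹ - f) : HeisenbergExt F W C) ∈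
      derivedSeries (HeisenbergExt F W C) 1 := by
  have : (ofF (f ∘ₗ DistribSMul.toLinearMap F W c⁻¹ - f) : HeisenbergExt F W C) =
      ⁅(ofC c : HeisenbergExt F W C), ofF f⁆ := by
    ext <;> simp [commutatorElement_def, ofF, sub_eq_add_neg]
  rw [this, derivedSeries_one]
  exact Subgroup.commutator_mem_commutator trivial trivial

theorem derivedSeries_two_ne_bot {c : C} {w : W} (h : c⁻¹ • (c • w - w) - (c • w - w) ≠ 0) :
    derivedSeries (HeisenbergExt F W C) 2 ≠ ⊥ := by
  obtain ⟨f, hf⟩ : ∃ f : W →ₗ[F] F, f (c⁻¹ • (c • w - w) - (c • w - w)) ≠ 0 := by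
    by_contra! hcon
    exact h ((Module.forall_dual_apply_eq_zero_iff F _).mp hcon)
  intro hbot
  have hmem := Subgroup.commutator_mem_commutator (ofF_mem_derivedSeries_one c f)
    (ofW_mem_derivedSeries_one (F := F) c w)
  rw [← derivedSeries_succ, hbot, Subgroup.mem_bot, commutatorElement_eq_one_iff_mul_comm,
    mul_eq_mul_ofT rfl rfl] at hmem
  refine hf ?_
  have := congrArg HeisenbergExt.t (mul_eq_right.mp hmem)
  simpa [ofT, ofF, ofW] using this

end Derived

section Characters

variable {V : Type*} [AddCommGroup V] [Module ℂ V]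
  {ρ : Representation ℂ (HeisenbergExt F W C) V}

/-- A vector that is an eigenvector of a generator of the acting group is an eigenvector of the
whole acting group. -/
theorem exists_ofC_apply_eq_smul {c : C} (hc : Subgroup.zpowers c = ⊤) {u : V} {μ : ℂ}
    [Finite C] (hu : ρ (ofC c) u = μ • u) (d : C) : ∃ ν : ℂ, ρ (ofC d) u = ν • u := by
  have hd : d ∈ Submonoid.powers c := by
    rw [mem_powers_iff_mem_zpowers, hc]; trivial
  obtain ⟨k, rfl⟩ := hd
  refine ⟨μ ^ k, ?_⟩
  rw [map_pow, map_pow]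
  induction k with
  | zero => simp
  | succ k ih => rw [pow_succ', End.mul_apply, ih, map_smul, hu, smul_smul, pow_succ]

variable [FiniteDimensional ℂ V]

/-- An irreducible representation that is trivial on the centre of the Heisenberg group has
dimension `1` or the order of the acting group, if that order is prime. -/
theorem finrank_eq_of_center_trivial (hρ : ρ.IsIrreducible) (hT : ∀ t, ρ (ofT t) = 1)
    (hC : (Nat.card C).Prime) : finrank ℂ V = 1 ∨ finrank ℂ V = Nat.card C := by
  have := hρ.nontrivial
  have : Finite C := Nat.finite_of_card_ne_zero hC.ne_zero
  let E := {x : HeisenbergExt F W C // x.c = 1}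
  obtain ⟨v, hv, hχ⟩ := exists_joint_eigenvector (fun e : E => ρ e.1) fun x y => by
    rw [Commute, SemiconjBy, ← map_mul, mul_eq_mul_ofT x.2 y.2, map_mul, hT, one_mul, map_mul]
  choose χ hχ using hχ
  let conj (d : C) (e : E) : E := ⟨ofC d⁻¹ * e.1 * ofC d, by simp [e.2]⟩
  have hconj : ∀ d (e : E), e.1 * ofC d = ofC d * (conj d e).1 := fun d e => by
    simp only [conj, map_inv]; group
  by_cases hstab : ∃ c : C, c ≠ 1 ∧ ∀ e, χ (conj c e) = χ e
  · left
    obtain ⟨c, hc, hce⟩ := hstab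
    let U : Submodule ℂ V := ⨅ e : E, End.eigenspace (ρ e.1) (χ e)
    have hmem : ∀ u, u ∈ U ↔ ∀ e : E, ρ e.1 u = χ e • u := fun u => by
      simp [U, Submodule.mem_iInf]
    obtain ⟨u, huU, hu, μ, hμ⟩ := exists_eigenvector_mem (ρ (ofC c)) U
      (fun h => hv ((Submodule.mem_bot ℂ).mp (h ▸ (hmem v).mpr hχ))) fun u hu => by
        rw [hmem] at hu ⊢
        intro e
        rw [← End.mul_apply, ← map_mul, hconj, map_mul, End.mul_apply, hu, map_smul, hce]
    have hgen : Subgroup.zpowers c = ⊤ :=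
      have := Fact.mk hC
      zpowers_eq_top_of_prime_card rfl hc
    have hspan : ∀ g, ∃ _ : Unit, ∃ ν : ℂ, ρ g u = ν • ρ 1 u := fun g => by
      obtain ⟨ν, hν⟩ := exists_ofC_apply_eq_smul hgen hμ g.c
      refine ⟨(), ν * χ ⟨ofW g.w * (ofT g.t * ofF g.f), by simp [ofW, ofT, ofF]⟩, ?_⟩
      conv_lhs => rw [eq_mul g]
      rw [← mul_assoc (ofT _), ← mul_assoc, map_mul, End.mul_apply, hν, map_smul,
        (hmem u).mp huU ⟨ofW g.w * (ofT g.t * ofF g.f), by simp [ofW, ofT, ofF]⟩, smul_smul]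
      simp
    simpa using hρ.finrank_eq_card (ι := Unit) (κ := Unit) (fun _ => 1) (fun _ => 1) 1 hu
      hspan (by simp) (Function.injective_of_subsingleton _)
  · right
    push Not at hstab
    refine hρ.finrank_eq_card (κ := E) ofC (fun e => e.1) (fun d e => χ (conj d e)) hv
      (fun g => ?_) (fun d e => ?_) fun d d' hdd => ?_
    · refine ⟨g.c, χ (conj g.c ⟨ofW g.w * (ofT g.t * ofF g.f), by simp [ofW, ofT, ofF]⟩), ?_⟩
      conv_lhs => rw [eq_mul g]
      rw [← mul_assoc (ofT _), ← mul_assoc,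
        hconj g.c ⟨ofW g.w * (ofT g.t * ofF g.f), by simp [ofW, ofT, ofF]⟩,
        map_mul, End.mul_apply, hχ, map_smul]
    · rw [← End.mul_apply, ← map_mul, hconj, map_mul, End.mul_apply, hχ, map_smul]
    · by_contra hne
      obtain ⟨e, he⟩ := hstab (d⁻¹ * d') (by simpa [inv_mul_eq_one] using hne)
      refine he ?_
      have h := congrFun hdd (conj d⁻¹ e)
      have h1 : conj d (conj d⁻¹ e) = e := Subtype.ext (by simp only [conj, map_inv]; group)
      have h2 : conj d' (conj d⁻¹ e) = conj (d⁻¹ * d') e :=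
        Subtype.ext (by simp only [conj, map_inv, map_mul]; group)
      simp only [h1, h2] at h
      exact h.symm

/-- An irreducible representation that is nontrivial on the centre of the Heisenberg group of `W`
has dimension `|W|`, if the acting group is cyclic. -/
theorem finrank_eq_of_center_nontrivial [Finite F] [Finite W] [Finite C] [IsCyclic C]
    (hρ : ρ.IsIrreducible) {s : F} (hs : ρ (ofT s) ≠ 1) : finrank ℂ V = Nat.card W := by
  have := hρ.nontrivial
  choose ψ hψ using fun t : F => hρ.exists_scalar_of_central (commute_ofT (W := W) (C := C) t)
  have hψs : ψ s ≠ 1 := fun h => hs <| by ext v; simp [hψ, h]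
  have hψadd : ∀ a b, ψ (a + b) = ψ a * ψ b := fun a b => by
    obtain ⟨v, hv⟩ := exists_ne (0 : V)
    refine smul_left_injective ℂ hv ?_
    simp only
    rw [← hψ, ofT_add, map_mul, End.mul_apply, hψ, hψ, smul_smul]
  have hsurj : ∀ (g : W →ₗ[F] F), g ≠ 0 → ∃ w, g w = s := fun g hg =>
    LinearMap.surjective_of_ne_zero hg s
  have htrace : ∀ f : W →ₗ[F] F, f ≠ 0 → LinearMap.trace ℂ V (ρ (ofF f)) = 0 := by
    intro f hf
    obtain ⟨w, hw⟩ := hsurj f hf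
    have h1 : ρ (ofF f) * ρ (ofW w) = ρ (ofW w) * (ψ s • ρ (ofF f)) := by
      rw [← map_mul, ofF_mul_ofW, map_mul, map_mul, hw]
      congr 1
      ext v
      simp [hψ]
    have h2 : ρ (ofF f) = ρ (ofW w) * (ψ s • ρ (ofF f)) * ρ (ofW w)⁻¹ := by
      rw [← h1, mul_assoc, ← map_mul, mul_inv_cancel, map_one, mul_one]
    have h3 := congrArg (LinearMap.trace ℂ V) h2
    rw [LinearMap.trace_mul_comm, ← mul_assoc, ← map_mul, inv_mul_cancel, map_one, one_mul,
      map_smul, smul_eq_mul] at h3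
    by_contra hne
    exact hψs (mul_eq_right₀ hne |>.mp h3.symm)
  have : Finite (W →ₗ[F] F) := DFunLike.finite _
  have := Fintype.ofFinite (W →ₗ[F] F)
  let e : End ℂ V := ∑ f : W →ₗ[F] F, ρ (ofF f)
  have he : e ≠ 0 := by
    intro h0
    have h := congrArg (LinearMap.trace ℂ V) h0
    rw [map_sum, Finset.sum_eq_single 0 (fun f _ hf => htrace f hf) (by simp),
      show (ofF 0 : HeisenbergExt F W C) = 1 from rfl, map_one, LinearMap.trace_one, map_zero] at h
    exact finrank_pos.ne' (Nat.cast_eq_zero.mp h)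
  obtain ⟨x, hx⟩ : ∃ x, e x ≠ 0 := by
    by_contra! h
    exact he (LinearMap.ext h)
  let U : Submodule ℂ V := ⨅ f : W →ₗ[F] F, End.eigenspace (ρ (ofF f)) 1
  have hmem : ∀ u, u ∈ U ↔ ∀ f, ρ (ofF f) u = u := fun u => by
    simp [U, Submodule.mem_iInf]
  have hxU : e x ∈ U := by
    rw [hmem]
    intro f
    simp only [e, LinearMap.sum_apply, map_sum]
    refine Fintype.sum_equiv (Equiv.addLeft f) _ _ fun g => ?_
    rw [Equiv.coe_addLeft, ofF_add, map_mul, End.mul_apply]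
  obtain ⟨c, hc⟩ := IsCyclic.exists_generator (α := C)
  have hgen : Subgroup.zpowers c = ⊤ := (Subgroup.eq_top_iff' _).mpr hc
  obtain ⟨u, huU, hu, μ, hμ⟩ := exists_eigenvector_mem (ρ (ofC c)) U
    (fun h => hx ((Submodule.mem_bot ℂ).mp (h ▸ hxU))) fun u hu => by
      rw [hmem] at hu ⊢
      intro f
      rw [← End.mul_apply, ← map_mul, ofF_mul_ofC, map_mul, End.mul_apply, hu]
  rw [hmem] at huU
  refine hρ.finrank_eq_card (κ := W →ₗ[F] F) ofW ofF (fun w f => ψ (f w)) hu (fun g => ?_)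
    (fun w f => ?_) fun w w' hww => ?_
  · obtain ⟨ν, hν⟩ := exists_ofC_apply_eq_smul hgen hμ g.c
    refine ⟨g.w, ψ g.t * ν, ?_⟩
    conv_lhs => rw [eq_mul g]
    simp only [map_mul, End.mul_apply, hν, map_smul, huU, hψ, smul_smul]
  · rw [← End.mul_apply, ← map_mul, ofF_mul_ofW, map_mul, End.mul_apply, map_mul, End.mul_apply,
      huU, hψ, map_smul]
  · by_contra hne
    obtain ⟨f, hf⟩ : ∃ f : W →ₗ[F] F, f (w - w') ≠ 0 := by
      by_contra! hcon
      exact hne (sub_eq_zero.mp ((Module.forall_dual_apply_eq_zero_iff F _).mp hcon))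
    have h := congrFun hww ((s / f (w - w')) • f)
    have hsplit : ((s / f (w - w')) • f) w = s + ((s / f (w - w')) • f) w' := by
      simp only [LinearMap.smul_apply, smul_eq_mul, map_sub] at hf ⊢
      field_simp
      ring
    simp only [hsplit, hψadd] at h
    have hne0 : ψ (((s / f (w - w')) • f) w') ≠ 0 := fun h0 => by
      obtain ⟨v, hv⟩ := exists_ne (0 : V)
      refine hv ?_
      have := hψ (((s / f (w - w')) • f) w' + -((s / f (w - w')) • f) w') v
      rw [hψadd, h0, zero_mul, zero_smul, add_neg_cancel,
        show (ofT 0 : HeisenbergExt F W C) = 1 from rfl, map_one] at this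
      exact this
    exact hψs (mul_eq_right₀ hne0 |>.mp h)

end Characters

theorem charDegrees_eq [Finite F] [Finite W] [Finite C] [IsCyclic C] (hC : (Nat.card C).Prime)
    {c : C} {w : W} (hcw : c • w ≠ w) :
    charDegrees (HeisenbergExt F W C) = {1, Nat.card C, Nat.card W} := by
  have : Finite (W →ₗ[F] F) := DFunLike.finite _
  have : Finite (HeisenbergExt F W C) := Finite.of_equiv _ equivProd.symm
  have hof : ∀ {V : Type} [AddCommGroup V] [Module ℂ V] [FiniteDimensional ℂ V]
      (ρ : Representation ℂ (HeisenbergExt F W C) V), ρ.IsIrreducible →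
      finrank ℂ V ∈ charDegrees (HeisenbergExt F W C) := fun ρ hρ =>
    ⟨FDRep.of ρ, FDRep.simple_of ρ hρ, rfl⟩
  apply Set.Subset.antisymm
  · rintro _ ⟨V, hV, rfl⟩
    have hρ := FDRep.isIrreducible_of_simple V
    by_cases hT : ∀ t, V.ρ (ofT t) = 1
    · rcases finrank_eq_of_center_trivial hρ hT hC with h | h <;> simp [h]
    · push Not at hT
      obtain ⟨s, hs⟩ := hT
      simp [finrank_eq_of_center_nontrivial hρ hs]
  · rintro _ (rfl | rfl | rfl)
    · rw [← finrank_self ℂ]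
      exact hof (Representation.trivial ℂ _ ℂ)
        { exists_pair_ne := ⟨⊥, ⊤, fun h =>
            bot_ne_top (congrArg Subrepresentation.toSubmodule h)⟩
          eq_bot_or_eq_top := fun U => (eq_bot_or_eq_top U.toSubmodule).imp
            (fun h => Subrepresentation.toSubmodule_injective h)
            (fun h => Subrepresentation.toSubmodule_injective h) }
    · obtain ⟨V, _, _, _, ρ, hρ, htriv, hne⟩ :=
        Representation.exists_irreducible_of_notMem
          (heisenbergCenter : Subgroup (HeisenbergExt F W C)) (g := ofW (c • w - w)) (by
            rintro ⟨t, ht⟩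
            exact hcw (sub_eq_zero.mp (congrArg HeisenbergExt.w ht)))
      rcases finrank_eq_of_center_trivial hρ (fun t => htriv _ ⟨t, rfl⟩) hC with h | h
      · exact absurd (ρ.apply_eq_one_of_finrank_eq_one h (ofW_mem_derivedSeries_one c w)) hne
      · exact h ▸ hof ρ hρ
    · obtain ⟨V, _, _, _, ρ, hρ, -, hne⟩ :=
        Representation.exists_irreducible_of_notMem (⊥ : Subgroup (HeisenbergExt F W C))
          (g := ofT 1) (fun h => one_ne_zero (congrArg HeisenbergExt.t (Subgroup.mem_bot.mp h)))
      exact finrank_eq_of_center_nontrivial hρ hne ▸ hof ρ hρ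

end HeisenbergExt

/-- The nilpotent endomorphism of a space with three distinguished coordinates that has a single
Jordan block of size three. -/
def jordanThree (F X : Type) [Field F] [AddCommGroup X] [Module F X] :
    End F (F × F × F × X) where
  toFun x := (x.2.1, x.2.2.1, 0, 0)
  map_add' _ _ := by simp
  map_smul' _ _ := by simp

theorem one_add_jordanThree_pow (p : ℕ) [hp : Fact p.Prime] (hodd : Odd p) (X : Type)
    [AddCommGroup X] [Module (ZMod p) X] : (1 + jordanThree (ZMod p) X) ^ p = 1 := by
  have hp3 : 3 ≤ p := by
    have := hp.out.two_le
    rcases hodd with ⟨k, rfl⟩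
    omega
  have : CharP (End (ZMod p) (ZMod p × ZMod p × ZMod p × X)) p :=
    charP_of_injective_algebraMap (R := ZMod p) (FaithfulSMul.algebraMap_injective _ _) p
  have h3 : jordanThree (ZMod p) X ^ 3 = 0 := by
    ext x <;> simp [jordanThree, pow_succ]
  rw [add_pow_char_of_commute _ (Commute.one_left _), one_pow, pow_eq_zero_of_le hp3 h3, add_zero]

theorem exists_group_dl_three_with_three_char_degrees (p n : ℕ)
    (hp : p.Prime) (hodd : Odd p) (hn : 3 ≤ n) :
    ∃ (P : Type) (_ : Group P) (_ : Finite P),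
      Nat.card P = p ^ (2 * n + 2) ∧
      derivedSeries P 2 ≠ ⊥ ∧ derivedSeries P 3 = ⊥ ∧
      charDegrees P = {1, p, p ^ n} := by
  have := Fact.mk hp
  let F := ZMod p
  let W := F × F × F × (Fin (n - 3) → F)
  let u : (End F W)ˣ := Units.ofPowEqOne (1 + jordanThree F (Fin (n - 3) → F)) p
    (one_add_jordanThree_pow p hodd _) hp.ne_zero
  let C := Subgroup.zpowers u
  let c : C := ⟨u, Subgroup.mem_zpowers u⟩
  let w : W := (0, 0, 1, 0)
  have hcw : c • w ≠ w := fun h => by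
    have h' : (0 : F) + 1 = 0 := congrArg (fun x : W => x.2.1) h
    simp at h'
  have hu1 : u ≠ 1 := fun h => hcw <| by
    rw [show c = 1 from Subtype.ext h, one_smul]
  have hcardC : Nat.card C = p := by
    rw [Nat.card_zpowers]
    exact orderOf_eq_prime (Units.ext (one_add_jordanThree_pow p hodd _)) hu1
  have hcardF : Nat.card F = p := Nat.card_zmod p
  have hcardW : Nat.card W = p ^ n := by
    simp only [W, Nat.card_prod, Nat.card_fun, hcardF, Nat.card_fin]
    rw [← pow_succ', ← pow_succ', ← pow_succ']
    congr 1
    omega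
  have : Finite C := Nat.finite_of_card_ne_zero (hcardC.symm ▸ hp.ne_zero)
  have hfin : Finite (HeisenbergExt F W C) := Nat.finite_of_card_ne_zero (by
    rw [HeisenbergExt.natCard_eq, hcardC, hcardF, hcardW]
    have := hp.pos
    positivity)
  refine ⟨HeisenbergExt F W C, inferInstance, hfin, ?_, ?_,
    HeisenbergExt.derivedSeries_three_eq_bot, ?_⟩
  · rw [HeisenbergExt.natCard_eq, hcardC, hcardF, hcardW]
    ring
  · refine HeisenbergExt.derivedSeries_two_ne_bot (c := c) (w := w) fun h => ?_
    rw [sub_eq_zero, inv_smul_eq_iff] at h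
    have h' : (0 + 0 - 0 : F) = (0 + 0 - 0) + (0 + 1 - 0) := congrArg (fun x : W => x.1) h
    simp at h'
  · rw [HeisenbergExt.charDegrees_eq (hcardC.symm ▸ hp) hcw, hcardC, hcardW]
end

section
/- Let p ≥ 5 be a prime. Then there exists a finite group P of order p^6 such that P has derived length exactly 3 (P'' ≠ 1 and P''' = 1), P has a normal subgroup G of index p which is an extraspecial p-group of order p^5 and exponent p, and cd(P) = {1, p, p^2}. -/
/-- The extension of the Heisenberg group on the polynomials `a + b X + c X ^ 2 + d X ^ 3` over
`ZMod p`, with centre coordinate `z`, by the shifts `X ↦ X + t`. -/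
@[ext] structure ShiftGroup (p : ℕ) where
  a : ZMod p
  b : ZMod p
  c : ZMod p
  d : ZMod p
  z : ZMod p
  t : ZMod p

namespace ShiftGroup

variable {p : ℕ}

instance : Mul (ShiftGroup p) where
  mul x y :=
    { a := x.a + (y.a + y.b * x.t + y.c * x.t ^ 2 + y.d * x.t ^ 3)
      b := x.b + (y.b + 2 * y.c * x.t + 3 * y.d * x.t ^ 2)
      c := x.c + (y.c + 3 * y.d * x.t)
      d := x.d + y.d
      z := x.z + y.z
        + (3 * (x.a * y.d - x.d * (y.a + y.b * x.t + y.c * x.t ^ 2 + y.d * x.t ^ 3))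
          - (x.b * (y.c + 3 * y.d * x.t) - x.c * (y.b + 2 * y.c * x.t + 3 * y.d * x.t ^ 2)))
      t := x.t + y.t }

instance : One (ShiftGroup p) where
  one := ⟨0, 0, 0, 0, 0, 0⟩

instance : Inv (ShiftGroup p) where
  inv x :=
    { a := -(x.a - x.b * x.t + x.c * x.t ^ 2 - x.d * x.t ^ 3)
      b := -(x.b - 2 * x.c * x.t + 3 * x.d * x.t ^ 2)
      c := -(x.c - 3 * x.d * x.t)
      d := -x.d
      z := -x.z
      t := -x.t }

section Coordinates

variable (x y : ShiftGroup p)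

@[simp] theorem mul_a : (x * y).a = x.a + (y.a + y.b * x.t + y.c * x.t ^ 2 + y.d * x.t ^ 3) := rfl
@[simp] theorem mul_b : (x * y).b = x.b + (y.b + 2 * y.c * x.t + 3 * y.d * x.t ^ 2) := rfl
@[simp] theorem mul_c : (x * y).c = x.c + (y.c + 3 * y.d * x.t) := rfl
@[simp] theorem mul_d : (x * y).d = x.d + y.d := rfl
@[simp] theorem mul_z : (x * y).z = x.z + y.z
        + (3 * (x.a * y.d - x.d * (y.a + y.b * x.t + y.c * x.t ^ 2 + y.d * x.t ^ 3))
          - (x.b * (y.c + 3 * y.d * x.t)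
            - x.c * (y.b + 2 * y.c * x.t + 3 * y.d * x.t ^ 2))) := rfl
@[simp] theorem mul_t : (x * y).t = x.t + y.t := rfl
@[simp] theorem one_a : (1 : ShiftGroup p).a = 0 := rfl
@[simp] theorem one_b : (1 : ShiftGroup p).b = 0 := rfl
@[simp] theorem one_c : (1 : ShiftGroup p).c = 0 := rfl
@[simp] theorem one_d : (1 : ShiftGroup p).d = 0 := rfl
@[simp] theorem one_z : (1 : ShiftGroup p).z = 0 := rfl
@[simp] theorem one_t : (1 : ShiftGroup p).t = 0 := rfl
@[simp] theorem inv_a : x⁻¹.a = -(x.a - x.b * x.t + x.c * x.t ^ 2 - x.d * x.t ^ 3) := rfl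
@[simp] theorem inv_b : x⁻¹.b = -(x.b - 2 * x.c * x.t + 3 * x.d * x.t ^ 2) := rfl
@[simp] theorem inv_c : x⁻¹.c = -(x.c - 3 * x.d * x.t) := rfl
@[simp] theorem inv_d : x⁻¹.d = -x.d := rfl
@[simp] theorem inv_z : x⁻¹.z = -x.z := rfl
@[simp] theorem inv_t : x⁻¹.t = -x.t := rfl

end Coordinates

instance : Group (ShiftGroup p) :=
  Group.ofLeftAxioms
    (fun x y w => by ext <;> simp <;> ring)
    (fun x => by ext <;> simp)
    (fun x => by ext <;> simp <;> ring)

/-- An element is determined by its six coordinates. -/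
def equivProd (p : ℕ) :
    ShiftGroup p ≃ ZMod p × ZMod p × ZMod p × ZMod p × ZMod p × ZMod p where
  toFun x := (x.a, x.b, x.c, x.d, x.z, x.t)
  invFun x := ⟨x.1, x.2.1, x.2.2.1, x.2.2.2.1, x.2.2.2.2.1, x.2.2.2.2.2⟩
  left_inv _ := rfl
  right_inv _ := rfl

instance [NeZero p] : Finite (ShiftGroup p) := Finite.of_equiv _ (equivProd p).symm

theorem card_eq : Nat.card (ShiftGroup p) = p ^ 6 := by
  rw [Nat.card_congr (equivProd p)]
  simp only [Nat.card_prod, Nat.card_zmod]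
  ring

/-- The projection onto the shift coordinate. -/
def shiftHom (p : ℕ) : ShiftGroup p →* Multiplicative (ZMod p) where
  toFun x := Multiplicative.ofAdd x.t
  map_one' := rfl
  map_mul' _ _ := rfl

/-- The Heisenberg part of the group. -/
def heis (p : ℕ) : Subgroup (ShiftGroup p) := (shiftHom p).ker

instance : (heis p).Normal := by unfold heis; infer_instance

@[simp] theorem mem_heis {x : ShiftGroup p} : x ∈ heis p ↔ x.t = 0 := Iff.rfl

theorem index_heis : (heis p).index = p := by
  rw [heis, Subgroup.index_ker, MonoidHom.range_eq_top.2 fun t => ⟨⟨0, 0, 0, 0, 0, t.toAdd⟩, rfl⟩,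
    Subgroup.card_top, Nat.card_congr Multiplicative.toAdd, Nat.card_zmod]

theorem card_heis [NeZero p] : Nat.card (heis p) = p ^ 5 := by
  have h := (heis p).card_mul_index
  rw [index_heis, card_eq, pow_succ] at h
  exact Nat.eq_of_mul_eq_mul_right (Nat.pos_of_ne_zero (NeZero.ne p)) h

theorem pow_of_mem_heis {x : ShiftGroup p} (hx : x ∈ heis p) (n : ℕ) :
    x ^ n = ⟨n * x.a, n * x.b, n * x.c, n * x.d, n * x.z, 0⟩ := by
  rw [mem_heis] at hx
  induction n with
  | zero => ext <;> simp
  | succ n ih => rw [pow_succ, ih]; ext <;> simp [hx] <;> ring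

theorem pow_p_of_mem_heis {x : ShiftGroup p} (hx : x ∈ heis p) : x ^ p = 1 := by
  rw [pow_of_mem_heis hx]
  ext <;> simp

/-- The elements all of whose coordinates other than the central one vanish. -/
def zeta (w : ZMod p) : ShiftGroup p := ⟨0, 0, 0, 0, w, 0⟩

/-- The central coordinate subgroup. -/
def centre (p : ℕ) : Subgroup (ShiftGroup p) where
  carrier := {x | x.a = 0 ∧ x.b = 0 ∧ x.c = 0 ∧ x.d = 0 ∧ x.t = 0}
  mul_mem' := by
    rintro x y ⟨h1, h2, h3, h4, h5⟩ ⟨k1, k2, k3, k4, k5⟩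
    simp [*]
  one_mem' := by simp
  inv_mem' := by
    rintro x ⟨h1, h2, h3, h4, h5⟩
    simp [*]

theorem mem_centre {x : ShiftGroup p} :
    x ∈ centre p ↔ x.a = 0 ∧ x.b = 0 ∧ x.c = 0 ∧ x.d = 0 ∧ x.t = 0 := Iff.rfl

theorem zeta_mem_centre (w : ZMod p) : zeta w ∈ centre p := by simp [mem_centre, zeta]

theorem eq_zeta_of_mem_centre {x : ShiftGroup p} (hx : x ∈ centre p) : x = zeta x.z := by
  obtain ⟨h1, h2, h3, h4, h5⟩ := hx
  ext <;> simp [zeta, *]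

theorem zeta_comm (w : ZMod p) (x : ShiftGroup p) : zeta w * x = x * zeta w := by
  ext <;> simp [zeta]; ring

instance : (centre p).Normal where
  conj_mem x hx g := by
    rw [eq_zeta_of_mem_centre hx, ← zeta_comm, mul_inv_cancel_right]
    exact zeta_mem_centre _

open scoped commutatorElement

theorem commutatorElement_of_mem_heis {x y : ShiftGroup p} (hx : x ∈ heis p) (hy : y ∈ heis p) :
    ⁅x, y⁆ = zeta (6 * (x.a * y.d - x.d * y.a) - 2 * (x.b * y.c - x.c * y.b)) := by
  rw [mem_heis] at hx hy
  rw [commutatorElement_def]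
  ext <;> simp [zeta, hx, hy]; ring

theorem commutator_heis_le : ⁅heis p, heis p⁆ ≤ centre p := by
  rw [Subgroup.commutator_le]
  intro x hx y hy
  rw [commutatorElement_of_mem_heis hx hy]
  exact zeta_mem_centre _

theorem derivedSeries_three : derivedSeries (ShiftGroup p) 3 = ⊥ := by
  have h1 : derivedSeries (ShiftGroup p) 1 ≤ heis p := by
    rw [derivedSeries_one, heis]
    exact Abelianization.commutator_subset_ker _
  have h2 : derivedSeries (ShiftGroup p) 2 ≤ centre p :=
    (Subgroup.commutator_mono h1 h1).trans commutator_heis_le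
  rw [derivedSeries_succ, Subgroup.commutator_eq_bot_iff_le_centralizer]
  intro x hx y hy
  rw [eq_zeta_of_mem_centre (h2 hx), zeta_comm]

theorem natCast_ne_zero_of_lt {n : ℕ} (h0 : n ≠ 0) (hn : n < p) : (n : ZMod p) ≠ 0 := by
  rw [Ne, ZMod.natCast_eq_zero_iff]
  exact Nat.not_dvd_of_pos_of_lt (Nat.pos_of_ne_zero h0) hn

theorem two_ne_zero' (hp5 : 5 ≤ p) : (2 : ZMod p) ≠ 0 := by
  exact_mod_cast natCast_ne_zero_of_lt (p := p) two_ne_zero (by omega)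

theorem three_ne_zero' (hp5 : 5 ≤ p) : (3 : ZMod p) ≠ 0 := by
  exact_mod_cast natCast_ne_zero_of_lt (p := p) three_ne_zero (by omega)

theorem commutatorElement_shift_notMem_centre (hp5 : 5 ≤ p) :
    ⁅(⟨0, 0, 0, 0, 0, 1⟩ : ShiftGroup p), ⟨0, 0, 1, 0, 0, 0⟩⁆ ∉ centre p := by
  intro h
  have hb := h.2.1
  simp [commutatorElement_def] at hb
  exact two_ne_zero' hp5 hb

theorem six_ne_zero' [Fact p.Prime] (hp5 : 5 ≤ p) : (6 : ZMod p) ≠ 0 := by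
  have h := mul_ne_zero (two_ne_zero' hp5) (three_ne_zero' hp5)
  norm_num at h
  exact h

theorem derivedSeries_two_ne_bot [Fact p.Prime] (hp5 : 5 ≤ p) :
    derivedSeries (ShiftGroup p) 2 ≠ ⊥ := by
  intro h
  have hx : ⁅(⟨0, 0, 0, 0, 0, 1⟩ : ShiftGroup p), ⟨0, 0, 1, 0, 0, 0⟩⁆ ∈
      derivedSeries (ShiftGroup p) 1 :=
    Subgroup.commutator_mem_commutator (Subgroup.mem_top _) (Subgroup.mem_top _)
  have hy : ⁅(⟨0, 0, 0, 0, 0, 1⟩ : ShiftGroup p), ⟨0, 0, 0, 1, 0, 0⟩⁆ ∈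
      derivedSeries (ShiftGroup p) 1 :=
    Subgroup.commutator_mem_commutator (Subgroup.mem_top _) (Subgroup.mem_top _)
  have hxy := Subgroup.commutator_mem_commutator hx hy
  rw [← derivedSeries_succ, h, Subgroup.mem_bot,
    commutatorElement_of_mem_heis (by simp [commutatorElement_def])
      (by simp [commutatorElement_def])] at hxy
  have hz := congrArg ShiftGroup.z hxy
  simp [commutatorElement_def, zeta] at hz
  exact hz.elim (two_ne_zero' hp5) (three_ne_zero' hp5)

theorem eq_one_of_mem_frattini {G : Type*} [Group G] [Fact p.Prime]
    (φ : G →* Multiplicative (ZMod p)) {x : G} (hx : x ∈ frattini G) : φ x = 1 := by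
  have : IsSimpleGroup (Multiplicative (ZMod p)) :=
    isSimpleGroup_of_prime_card (p := p) (by rw [Nat.card_congr Multiplicative.toAdd, Nat.card_zmod])
  rcases eq_bot_or_eq_top φ.range with h | h
  · exact (Subgroup.mem_bot).1 (h ▸ ⟨x, rfl⟩)
  · exact frattini_le_coatom isCoatom_bot
      (frattini_le_comap_frattini_of_surjective (MonoidHom.range_eq_top.1 h) hx)

theorem center_le_frattini {G : Type*} [Group G] (h : Subgroup.center G ≤ commutator G) :
    Subgroup.center G ≤ frattini G := by
  simp_rw [frattini, Order.radical, le_iInf_iff]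
  intro M hM
  by_contra hle
  have hsup : M ⊔ Subgroup.center G = ⊤ := hM.2 _ (left_lt_sup.2 hle)
  refine hle (h.trans ?_)
  rw [commutator_def, Subgroup.commutator_le]
  have hmem : ∀ x : G, ∃ m ∈ M, ∃ c ∈ Subgroup.center G, m * c = x := fun x =>
    Subgroup.mem_sup_of_normal_right.1 (hsup ▸ Subgroup.mem_top x)
  intro x _ y _
  obtain ⟨m, hm, c, hc, rfl⟩ := hmem x
  obtain ⟨n, hn, e, he, rfl⟩ := hmem y
  rw [Subgroup.mem_center_iff] at hc he
  have key : ⁅m * c, n * e⁆ = ⁅m, n⁆ := by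
    calc ⁅m * c, n * e⁆ = m * (c * (n * e)) * c⁻¹ * m⁻¹ * e⁻¹ * n⁻¹ := by
          rw [commutatorElement_def]; group
      _ = m * (n * (e * m⁻¹)) * e⁻¹ * n⁻¹ := by rw [← hc]; group
      _ = ⁅m, n⁆ := by rw [← he, commutatorElement_def]; group
  rw [key]
  exact M.mul_mem (M.mul_mem (M.mul_mem hm hn) (M.inv_mem hm)) (M.inv_mem hn)

/-- An additive coordinate, as a homomorphism on the Heisenberg part. -/
def coordHom (f : ShiftGroup p → ZMod p)
    (hf : ∀ x ∈ heis p, ∀ y ∈ heis p, f (x * y) = f x + f y) :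
    heis p →* Multiplicative (ZMod p) :=
  MonoidHom.mk' (fun x => Multiplicative.ofAdd (f x)) fun x y => hf x x.2 y y.2

theorem center_heis [Fact p.Prime] (hp5 : 5 ≤ p) :
    Subgroup.center (heis p) = (centre p).subgroupOf (heis p) := by
  have h2 := two_ne_zero' hp5
  have h6 := six_ne_zero' hp5
  ext x
  rw [Subgroup.mem_center_iff, Subgroup.mem_subgroupOf]
  constructor
  · intro h
    have hxy : ∀ y ∈ heis p, 6 * ((x : ShiftGroup p).a * y.d - (x : ShiftGroup p).d * y.a)
        - 2 * ((x : ShiftGroup p).b * y.c - (x : ShiftGroup p).c * y.b) = 0 := by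
      intro y hy
      have hc := congrArg Subtype.val (h ⟨y, hy⟩)
      have h1 := commutatorElement_of_mem_heis x.2 hy
      rw [commutatorElement_eq_one_iff_mul_comm.2 hc.symm] at h1
      exact (congrArg ShiftGroup.z h1).symm
    refine ⟨?_, ?_, ?_, ?_, x.2⟩
    · simpa [h6] using hxy ⟨0, 0, 0, 1, 0, 0⟩ rfl
    · simpa [h2] using hxy ⟨0, 0, 1, 0, 0, 0⟩ rfl
    · simpa [h2] using hxy ⟨0, 1, 0, 0, 0, 0⟩ rfl
    · simpa [h6] using hxy ⟨1, 0, 0, 0, 0, 0⟩ rfl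
  · intro h y
    refine Subtype.ext ?_
    rw [Subgroup.coe_mul, Subgroup.coe_mul, eq_zeta_of_mem_centre h, zeta_comm]

theorem commutator_heis [Fact p.Prime] (hp5 : 5 ≤ p) :
    commutator (heis p) = (centre p).subgroupOf (heis p) := by
  apply le_antisymm
  · rw [commutator_def, Subgroup.commutator_le]
    intro x _ y _
    exact commutator_heis_le (Subgroup.commutator_mem_commutator x.2 y.2)
  · intro x hx
    have h6 := six_ne_zero' hp5
    have hxz : x = ⁅(⟨⟨(x : ShiftGroup p).z / 6, 0, 0, 0, 0, 0⟩, rfl⟩ : heis p),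
        ⟨⟨0, 0, 0, 1, 0, 0⟩, rfl⟩⁆ := by
      refine Subtype.ext (Eq.trans ?_ (commutatorElement_of_mem_heis (Subtype.prop _)
        (Subtype.prop _)).symm)
      refine (eq_zeta_of_mem_centre hx).trans ?_
      simp [mul_div_cancel₀ _ h6, zeta]
    rw [hxz]
    exact Subgroup.commutator_mem_commutator (Subgroup.mem_top _) (Subgroup.mem_top _)

theorem isExtraspecial_heis [Fact p.Prime] (hp5 : 5 ≤ p) : IsExtraspecial p (heis p) := by
  have hcc : Subgroup.center (heis p) = commutator (heis p) :=
    (center_heis hp5).trans (commutator_heis hp5).symm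
  refine ⟨IsPGroup.of_card card_heis, hcc, le_antisymm ?_ ?_, ?_⟩
  · exact hcc ▸ center_le_frattini hcc.le
  · rw [commutator_heis hp5]
    intro x hx
    have hcoord : ∀ (f : ShiftGroup p → ZMod p)
        (_ : ∀ x ∈ heis p, ∀ y ∈ heis p, f (x * y) = f x + f y), f x = 0 := fun f hf =>
      eq_one_of_mem_frattini (coordHom f hf) hx
    refine ⟨hcoord ShiftGroup.a ?_, hcoord ShiftGroup.b ?_, hcoord ShiftGroup.c ?_,
      hcoord ShiftGroup.d ?_, x.2⟩ <;>
    · intro x hx y hy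
      rw [mem_heis] at hx
      simp [hx]
  · rw [center_heis hp5, Nat.card_congr (Subgroup.subgroupOfEquivOfLe
      (fun x hx => hx.2.2.2.2 : centre p ≤ heis p)).toEquiv]
    have e : centre p ≃ ZMod p :=
      { toFun := fun x => x.1.z
        invFun := fun w => ⟨zeta w, zeta_mem_centre w⟩
        left_inv := fun x => Subtype.ext (eq_zeta_of_mem_centre x.2).symm
        right_inv := fun w => rfl }
    rw [Nat.card_congr e, Nat.card_zmod]

end ShiftGroup

theorem exists_joint_eigenvector_s11 {K V ι : Type*} [Field K] [IsAlgClosed K] [AddCommGroup V]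
    [Module K V] [FiniteDimensional K V] [Finite ι] (f : ι → Module.End K V)
    (hf : ∀ i j, Commute (f i) (f j)) (W : Submodule K V) (hW : W ≠ ⊥)
    (hfW : ∀ i, ∀ v ∈ W, f i v ∈ W) :
    ∃ v ∈ W, v ≠ 0 ∧ ∃ χ : ι → K, ∀ i, f i v = χ i • v := by
  classical
  have key : ∀ s : Finset ι, ∃ χ : ι → K, ∃ v ∈ W, v ≠ 0 ∧ ∀ i ∈ s, f i v = χ i • v := by
    intro s
    induction s using Finset.induction_on with
    | empty =>
      obtain ⟨v, hv, hv0⟩ := W.ne_bot_iff.1 hW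
      exact ⟨0, v, hv, hv0, by simp⟩
    | insert j s hj ih =>
      obtain ⟨χ, v, hvW, hv0, hv⟩ := ih
      let U : Submodule K V := W ⊓ ⨅ i ∈ s, Module.End.eigenspace (f i) (χ i)
      have hU : ∀ w, w ∈ U ↔ w ∈ W ∧ ∀ i ∈ s, f i w = χ i • w := by
        simp [U]
      have hfU : ∀ w ∈ U, f j w ∈ U := by
        intro w hw
        rw [hU] at hw ⊢
        refine ⟨hfW j w hw.1, fun i hi => ?_⟩
        rw [← Module.End.mul_apply, hf i j, Module.End.mul_apply, hw.2 i hi, map_smul]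
      have : Nontrivial U := ⟨⟨⟨v, (hU v).2 ⟨hvW, hv⟩⟩, 0, by simpa [Subtype.ext_iff] using hv0⟩⟩
      obtain ⟨μ, hμ⟩ := Module.End.exists_eigenvalue ((f j).restrict hfU)
      obtain ⟨w, hw⟩ := hμ.exists_hasEigenvector
      have hwU := (hU w).1 w.2
      refine ⟨Function.update χ j μ, w, hwU.1, by simpa using hw.2, fun i hi => ?_⟩
      obtain rfl | hi := Finset.mem_insert.1 hi
      · simpa using congrArg Subtype.val hw.apply_eq_smul
      · rw [Function.update_of_ne (fun h : i = j => hj (h ▸ hi)), hwU.2 i hi]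
  obtain ⟨_⟩ := nonempty_fintype ι
  obtain ⟨χ, v, hvW, hv0, hv⟩ := key Finset.univ
  exact ⟨v, hvW, hv0, χ, fun i => hv i (Finset.mem_univ i)⟩

/-- Simultaneous eigenvectors with pairwise distinct systems of eigenvalues under a monoid action
are linearly independent. -/
theorem linearIndependent_of_weights {K V ι A : Type*} [Field K] [AddCommGroup V] [Module K V]
    [Monoid A] (τ : Representation K A V) (v : ι → V) (hv : ∀ i, v i ≠ 0) (χ : ι → A → K)
    (hχ : Function.Injective χ) (h : ∀ i a, τ a (v i) = χ i a • v i) :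
    LinearIndependent K v := by
  let X : ι → (A →* K) := fun i =>
    { toFun := χ i
      map_one' := smul_left_injective K (hv i) (by simp [← h])
      map_mul' := fun a b => smul_left_injective K (hv i) (by
        change χ i (a * b) • v i = (χ i a * χ i b) • v i
        rw [← h, map_mul, Module.End.mul_apply, h, map_smul, h, smul_smul, mul_comm]) }
  have hX : Function.Injective X := fun i j hij => hχ (congrArg DFunLike.coe hij)
  have hlin := (linearIndependent_monoidHom A K).comp X hX
  rw [linearIndependent_iff'] at hlin ⊢
  intro s c hc i hi
  have hφ : ∀ φ : Module.Dual K V, φ (c i • v i) = 0 := by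
    intro φ
    rw [map_smul, smul_eq_mul]
    refine hlin s (fun j => c j * φ (v j)) ?_ i hi
    ext a
    have ha := congrArg (fun w => φ (τ a w)) hc
    simp only [map_sum, map_smul, map_zero, h, smul_eq_mul] at ha
    simp only [Finset.sum_apply, Pi.smul_apply, Function.comp_apply, smul_eq_mul, Pi.zero_apply]
    rw [← ha]
    exact Finset.sum_congr rfl fun j _ => by
      change c j * φ (v j) * χ j a = _
      ring
  exact (smul_eq_zero.1 ((Module.forall_dual_apply_eq_zero_iff K _).1 hφ)).resolve_right (hv i)

namespace Representation

/-- An irreducible representation generated by an eigenvector of the stabilizer of a weight has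
dimension the size of the orbit of that weight. -/
theorem IsIrreducible.finrank_eq_card_s11 {K V G ι A : Type*} [Field K] [AddCommGroup V] [Module K V]
    [Group G] [Monoid A] [Fintype ι] (ρ : Representation K G V) [ρ.IsIrreducible] (f : A →* G)
    (s : ι → G) {v : V} (hv : v ≠ 0) (hs : ∀ g, ∃ i, ∃ c : K, ρ g v = c • ρ (s i) v)
    (χ : ι → A → K) (hχ : Function.Injective χ)
    (h : ∀ i a, ρ (f a) (ρ (s i) v) = χ i a • ρ (s i) v) :
    Module.finrank K V = Fintype.card ι := by
  have hne : ∀ g, ρ g v ≠ 0 := fun g hg => hv (by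
    simpa [← Module.End.mul_apply, ← map_mul] using congrArg (ρ g⁻¹) hg)
  have hli := linearIndependent_of_weights (ρ.comp f) (fun i => ρ (s i) v) (fun i => hne _) χ hχ h
  let W : Subrepresentation ρ :=
    { toSubmodule := Submodule.span K (Set.range fun i => ρ (s i) v)
      apply_mem_toSubmodule := fun g w hw => by
        induction hw using Submodule.span_induction with
        | zero => simp
        | add x y _ _ hx hy => rw [map_add]; exact add_mem hx hy
        | smul a x _ hx => rw [map_smul]; exact Submodule.smul_mem _ _ hx
        | mem x hx =>
          obtain ⟨i, rfl⟩ := hx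
          obtain ⟨j, c, hj⟩ := hs (g * s i)
          rw [← Module.End.mul_apply, ← map_mul, hj]
          exact Submodule.smul_mem _ _ (Submodule.subset_span ⟨j, rfl⟩) }
  have hW : W = ⊤ := by
    refine (eq_bot_or_eq_top W).resolve_left fun hbot => ?_
    obtain ⟨i, -⟩ := hs 1
    have hmem : ρ (s i) v ∈ W.toSubmodule := Submodule.subset_span ⟨i, rfl⟩
    rw [hbot] at hmem
    exact hne _ hmem
  have hspan : Submodule.span K (Set.range fun i => ρ (s i) v) = ⊤ :=
    congrArg Subrepresentation.toSubmodule hW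
  rw [← finrank_top, ← hspan, finrank_span_eq_card hli]

theorem isIrreducible_toRepresentation_of_isAtom {K V G : Type*} [Field K] [AddCommGroup V]
    [Module K V] [Monoid G] {ρ : Representation K G V} {W : Subrepresentation ρ} (hW : IsAtom W) :
    W.toRepresentation.IsIrreducible := by
  have hW0 : W.toSubmodule ≠ ⊥ := fun h => hW.1 (Subrepresentation.toSubmodule_injective h)
  obtain ⟨w, hw, hw0⟩ := W.toSubmodule.ne_bot_iff.1 hW0
  refine { exists_pair_ne := ⟨⊥, ⊤, fun h => hw0 ?_⟩, eq_bot_or_eq_top := fun U => ?_ }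
  · have h' : (⟨w, hw⟩ : W.toSubmodule) ∈ (⊥ : Subrepresentation W.toRepresentation) := by
      rw [h]; exact Submodule.mem_top
    exact congrArg Subtype.val ((Submodule.mem_bot K).1 h')
  · let U' : Subrepresentation ρ :=
      { toSubmodule := U.toSubmodule.map W.toSubmodule.subtype
        apply_mem_toSubmodule := by
          rintro g _ ⟨x, hx, rfl⟩
          exact ⟨_, U.apply_mem_toSubmodule g hx, rfl⟩ }
    have hU' : U' ≤ W := Submodule.map_subtype_le W.toSubmodule U.toSubmodule
    rcases hW.le_iff.1 hU' with h | h
    · left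
      refine Subrepresentation.toSubmodule_injective
        (Submodule.map_injective_of_injective W.toSubmodule.subtype_injective ?_)
      exact (congrArg Subrepresentation.toSubmodule h).trans (Submodule.map_bot _).symm
    · right
      refine Subrepresentation.toSubmodule_injective
        (Submodule.map_injective_of_injective W.toSubmodule.subtype_injective ?_)
      exact (congrArg Subrepresentation.toSubmodule h).trans (Submodule.map_subtype_top _).symm

/-- An element acting nontrivially on a representation of a finite group acts nontrivially on
some irreducible subrepresentation. -/
theorem exists_isAtom_apply_ne {V G : Type*} [AddCommGroup V] [Module ℂ V] [Group G] [Finite G]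
    (ρ : Representation ℂ G V) {g : G} (hg : ρ g ≠ 1) :
    ∃ W : Subrepresentation ρ, IsAtom W ∧ ∃ w ∈ W, ρ g w ≠ w := by
  have : NeZero (Nat.card G : ℂ) := ⟨Nat.cast_ne_zero.2 Nat.card_pos.ne'⟩
  by_contra! hcon
  refine hg (LinearMap.ext fun v => ?_)
  have hv : ρ.asModuleEquiv.symm v ∈ sSup {m : Submodule (MonoidAlgebra ℂ G) ρ.asModule |
      IsSimpleModule (MonoidAlgebra ℂ G) m} := by
    rw [IsSemisimpleModule.sSup_simples_eq_top]
    exact Submodule.mem_top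
  rw [sSup_eq_iSup'] at hv
  change ρ g (ρ.asModuleEquiv.symm v) = ρ.asModuleEquiv.symm v
  generalize ρ.asModuleEquiv.symm v = x at hv ⊢
  induction hv using Submodule.iSup_induction' with
  | zero => exact map_zero (ρ g)
  | add x y _ _ hx hy => exact (map_add (ρ g) x y).trans (congrArg₂ (· + ·) hx hy)
  | mem i x hx =>
    refine hcon (Subrepresentation.subrepresentationSubmoduleOrderIso.symm i.1) ?_ x hx
    rw [OrderIso.isAtom_iff]
    exact isSimpleModule_iff_isAtom.1 i.2

end Representation

namespace FDRep

open CategoryTheory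

theorem isIrreducible_of_simple_s11 {G : Type} [Group G] (V : FDRep ℂ G) [Simple V] :
    Representation.IsIrreducible V.ρ := by
  have hV : ∃ v : V, v ≠ 0 := by
    by_contra! h
    refine id_nonzero V ?_
    ext v
    exact h _
  obtain ⟨v, hv⟩ := hV
  refine { exists_pair_ne := ⟨⊥, ⊤, fun h => hv ?_⟩, eq_bot_or_eq_top := fun W => ?_ }
  · have h' : v ∈ (⊥ : Subrepresentation V.ρ) := by rw [h]; exact Submodule.mem_top
    exact (Submodule.mem_bot ℂ).1 h'
  · let i : FDRep.of W.toRepresentation ⟶ V :=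
      forget₂HomLinearEquiv _ _ (Rep.ofHom ⟨W.toSubmodule.subtype, fun g => rfl⟩)
    have hi : ∀ w : W.toSubmodule, i w = w.1 := fun w => rfl
    have : Mono i := ConcreteCategory.mono_of_injective i fun x y hxy => Subtype.ext hxy
    by_cases h0 : i = 0
    · left
      refine Subrepresentation.toSubmodule_injective ((Submodule.eq_bot_iff _).2 fun w hw => ?_)
      exact (hi ⟨w, hw⟩).symm.trans (by rw [h0]; rfl)
    · right
      have := isIso_of_mono_of_nonzero h0
      refine Subrepresentation.toSubmodule_injective (Submodule.eq_top_iff'.2 fun w => ?_)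
      obtain ⟨x, rfl⟩ := (ConcreteCategory.bijective_of_isIso i).2 w
      rw [hi]
      exact x.2

theorem simple_of_isIrreducible {G V : Type} [Group G] [Finite G] [AddCommGroup V] [Module ℂ V]
    [FiniteDimensional ℂ V] (ρ : Representation ℂ G V) [ρ.IsIrreducible] :
    Simple (FDRep.of ρ) := by
  have : NeZero (Nat.card G : ℂ) := ⟨Nat.cast_ne_zero.2 Nat.card_pos.ne'⟩
  rw [simple_iff_end_is_rank_one,
    ← ((Rep.homLinearEquiv _ _).symm.trans (forget₂HomLinearEquiv (of ρ) (of ρ))).finrank_eq]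
  exact Representation.IsIrreducible.finrank_intertwiningMap_self ρ

/-- The quotient by a normal subgroup is separated by irreducible representations. -/
theorem exists_simple_apply_ne_one {G : Type} [Group G] [Finite G] (N : Subgroup G) [N.Normal]
    {g : G} (hg : g ∉ N) :
    ∃ V : FDRep ℂ G, Simple V ∧ (∀ n ∈ N, V.ρ n = 1) ∧ V.ρ g ≠ 1 := by
  let ρ := Representation.ofMulAction ℂ G (G ⧸ N)
  have hρ : ∀ n ∈ N, ρ n = 1 := by
    intro n hn
    ext x : 2
    induction x using QuotientGroup.induction_on with
    | H x =>
      have hx : n • (x : G ⧸ N) = x := by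
        rw [MulAction.Quotient.smul_coe, smul_eq_mul, QuotientGroup.eq]
        simpa [mul_assoc] using Subgroup.Normal.conj_mem ‹N.Normal› _ (N.inv_mem hn) x⁻¹
      simp [ρ, hx]
  have hρg : ρ g ≠ 1 := by
    intro h
    have h1 := LinearMap.congr_fun h (MonoidAlgebra.single ((1 : G) : G ⧸ N) 1)
    rw [Representation.ofMulAction_single, Module.End.one_apply] at h1
    have h2 := (MonoidAlgebra.single_left_inj one_ne_zero).1 h1
    rw [MulAction.Quotient.smul_coe, smul_eq_mul, mul_one, QuotientGroup.eq] at h2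
    exact hg (by simpa using h2)
  obtain ⟨W, hW, w, hw, hgw⟩ := Representation.exists_isAtom_apply_ne ρ hρg
  have := Representation.isIrreducible_toRepresentation_of_isAtom hW
  refine ⟨FDRep.of W.toRepresentation, simple_of_isIrreducible _, fun n hn => ?_, fun h => hgw ?_⟩
  · exact LinearMap.ext fun x => Subtype.ext (LinearMap.congr_fun (hρ n hn) x.1)
  · exact congrArg Subtype.val (LinearMap.congr_fun h ⟨w, hw⟩)

end FDRep

namespace Representation

theorem IsIrreducible.top_ne_bot {K G V : Type*} [Field K] [Group G] [AddCommGroup V] [Module K V]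
    (ρ : Representation K G V) [ρ.IsIrreducible] : (⊤ : Submodule K V) ≠ ⊥ := fun h =>
  bot_ne_top (α := Subrepresentation ρ) (Subrepresentation.toSubmodule_injective h.symm)

/-- Schur's lemma for central elements. -/
theorem IsIrreducible.exists_apply_eq_smul_of_central {V G : Type*} [AddCommGroup V]
    [Module ℂ V] [FiniteDimensional ℂ V] [Group G] (ρ : Representation ℂ G V) [ρ.IsIrreducible]
    {g : G} (hg : ∀ x, g * x = x * g) : ∃ c : ℂ, ∀ v, ρ g v = c • v := by
  have : Nontrivial V := by
    obtain ⟨v, -, hv⟩ := (Submodule.ne_bot_iff _).1 (top_ne_bot ρ)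
    exact ⟨v, 0, hv⟩
  obtain ⟨c, hc⟩ := Module.End.exists_eigenvalue (ρ g)
  let W : Subrepresentation ρ :=
    { toSubmodule := Module.End.eigenspace (ρ g) c
      apply_mem_toSubmodule := fun x v hv => by
        rw [Module.End.mem_eigenspace_iff] at hv ⊢
        rw [← Module.End.mul_apply, ← map_mul, hg, map_mul, Module.End.mul_apply, hv, map_smul] }
  have hW : W = ⊤ := (eq_bot_or_eq_top W).resolve_left fun h =>
    hc (congrArg Subrepresentation.toSubmodule h)
  refine ⟨c, fun v => Module.End.mem_eigenspace_iff.1 ?_⟩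
  exact (congrArg Subrepresentation.toSubmodule hW).ge (Submodule.mem_top (x := v))

theorem IsIrreducible.finrank_eq_one_of_eigenvector {K G V : Type*} [Field K] [Group G]
    [AddCommGroup V] [Module K V] (ρ : Representation K G V) [ρ.IsIrreducible] {v : V} (hv : v ≠ 0)
    (h : ∀ g, ∃ c : K, ρ g v = c • v) : Module.finrank K V = 1 := by
  choose χ hχ using h
  have hcard := finrank_eq_card_s11 ρ (1 : Unit →* G) (fun _ : Unit => 1) hv
    (fun g => ⟨(), χ g, by simp [hχ]⟩) (fun _ _ => 1) (Function.injective_of_subsingleton _)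
    (by simp)
  simpa using hcard

open scoped commutatorElement in
theorem apply_commutatorElement_of_finrank_eq_one {K G V : Type*} [Field K] [Group G]
    [AddCommGroup V] [Module K V] (ρ : Representation K G V) (h : Module.finrank K V = 1)
    (x y : G) : ρ ⁅x, y⁆ = 1 := by
  obtain ⟨v, -, hv⟩ := finrank_eq_one_iff'.1 h
  choose c hc using hv
  have hscalar : ∀ (f : Module.End K V) w, f w = c (f v) • w := by
    intro f w
    rw [← hc w, map_smul, smul_comm, hc (f v)]
  have hcomm : ρ x * ρ y = ρ y * ρ x := LinearMap.ext fun w => by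
    rw [Module.End.mul_apply, Module.End.mul_apply, hscalar (ρ x) (ρ y w),
      hscalar (ρ x) w, map_smul]
  rw [commutatorElement_def, map_mul, map_mul, map_mul, hcomm, ← map_mul, ← map_mul, ← map_mul,
    mul_inv_cancel_right, mul_inv_cancel, map_one]

end Representation

namespace AddChar

variable {p : ℕ} [Fact p.Prime] {ψ : AddChar (ZMod p) ℂ}

theorem isPrimitiveRoot_apply_one (hψ : ψ ≠ 1) : IsPrimitiveRoot (ψ 1) p := by
  rw [IsPrimitiveRoot.iff_orderOf]
  have hpow : ∀ x : ZMod p, ψ x = ψ 1 ^ x.val := fun x => by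
    rw [← map_nsmul_eq_pow, nsmul_one, ZMod.natCast_zmod_val]
  refine orderOf_eq_prime ?_ fun h => hψ ?_
  · rw [← map_nsmul_eq_pow]
    simp
  · ext x
    rw [hpow, h, one_pow, one_apply]

theorem exists_apply_eq_of_pow_eq_one (hψ : ψ ≠ 1) {μ : ℂ} (hμ : μ ^ p = 1) : ∃ k, ψ k = μ := by
  have : NeZero p := ⟨(Fact.out : p.Prime).ne_zero⟩
  obtain ⟨i, -, hi⟩ := (isPrimitiveRoot_apply_one hψ).eq_pow_of_pow_eq_one hμ
  exact ⟨i • 1, by rw [map_nsmul_eq_pow, hi]⟩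

end AddChar

namespace ShiftGroup

open scoped commutatorElement

variable {p : ℕ}

/-- The elements of the invariant Lagrangian. -/
def lagr (a b : ZMod p) : ShiftGroup p := ⟨a, b, 0, 0, 0, 0⟩

/-- The elements of the complementary Lagrangian. -/
def colagr (c d : ZMod p) : ShiftGroup p := ⟨0, 0, c, d, 0, 0⟩

/-- The shifts. -/
def shift (t : ZMod p) : ShiftGroup p := ⟨0, 0, 0, 0, 0, t⟩

theorem zeta_mul (v w : ZMod p) : zeta v * zeta w = zeta (v + w) := by
  ext <;> simp [zeta]

theorem lagr_mul (a b s t : ZMod p) : lagr a b * lagr s t = lagr (a + s) (b + t) := by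
  ext <;> simp [lagr]

theorem shift_mul (s t : ZMod p) : shift s * shift t = shift (s + t) := by
  ext <;> simp [shift]

theorem shift_pow (t : ZMod p) (n : ℕ) : shift t ^ n = shift ((n : ZMod p) * t) := by
  induction n with
  | zero => ext <;> simp [shift]
  | succ n ih => rw [pow_succ, ih, shift_mul]; congr 1; push_cast; ring

theorem lagr_pow (a b : ZMod p) (n : ℕ) :
    lagr a b ^ n = lagr ((n : ZMod p) * a) ((n : ZMod p) * b) := by
  rw [pow_of_mem_heis rfl]
  simp [lagr]

theorem lagr_mul_colagr (a b c d : ZMod p) :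
    lagr a b * colagr c d = colagr c d * lagr a b * zeta (6 * (a * d) - 2 * (b * c)) := by
  ext <;> simp [lagr, colagr, zeta]; ring

theorem lagr_mul_shift (a b t : ZMod p) :
    lagr a b * shift t = shift t * lagr (a - b * t) b := by
  ext <;> simp [lagr, shift]

theorem eq_colagr_mul (x : ShiftGroup p) :
    x = colagr x.c x.d * zeta (x.z - (x.c * x.b - 3 * (x.d * x.a))) * lagr x.a x.b * shift x.t := by
  ext <;> simp [lagr, shift, colagr, zeta]; ring

theorem shift_neg_mul_mem_heis (x : ShiftGroup p) : shift (-x.t) * x ∈ heis p := by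
  simp [shift]

/-- The elements of the invariant Lagrangian, as a homomorphism. -/
def lagrHom (p : ℕ) : Multiplicative (ZMod p × ZMod p) →* ShiftGroup p :=
  MonoidHom.mk' (fun q => lagr q.toAdd.1 q.toAdd.2) fun _ _ => (lagr_mul _ _ _ _).symm

theorem commute_apply_shift {V : Type*} [AddCommGroup V] [Module ℂ V]
    (ρ : Representation ℂ (ShiftGroup p) V) (s t : ZMod p) :
    Commute (ρ (shift s)) (ρ (shift t)) := by
  rw [commute_iff_eq, ← map_mul, ← map_mul, shift_mul, shift_mul, add_comm]

theorem apply_lagr_apply_colagr {V : Type*} [AddCommGroup V] [Module ℂ V]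
    {ρ : Representation ℂ (ShiftGroup p) V} {ψ : AddChar (ZMod p) ℂ}
    (hψ : ∀ w v, ρ (zeta w) v = ψ w • v) (a b c d : ZMod p) (v : V) :
    ρ (lagr a b) (ρ (colagr c d) v) =
      ψ (6 * (a * d) - 2 * (b * c)) • ρ (colagr c d) (ρ (lagr a b) v) := by
  simp only [← Module.End.mul_apply, ← map_mul]
  rw [lagr_mul_colagr, ← zeta_comm, map_mul, Module.End.mul_apply, hψ]

section Representations

variable [Fact p.Prime] {V : Type*} [AddCommGroup V] [Module ℂ V] [FiniteDimensional ℂ V]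
  (ρ : Representation ℂ (ShiftGroup p) V) [ρ.IsIrreducible]

theorem exists_centralChar :
    ∃ ψ : AddChar (ZMod p) ℂ, ∀ w v, ρ (zeta w) v = ψ w • v := by
  choose ψ hψ using fun w : ZMod p =>
    Representation.IsIrreducible.exists_apply_eq_smul_of_central ρ (zeta_comm w)
  obtain ⟨v, -, hv⟩ := (Submodule.ne_bot_iff _).1 (Representation.IsIrreducible.top_ne_bot ρ)
  refine ⟨⟨ψ, ?_, fun x y => ?_⟩, hψ⟩
  · refine smul_left_injective ℂ hv ?_
    change ψ 0 • v = (1 : ℂ) • v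
    rw [← hψ, one_smul]
    exact LinearMap.congr_fun (map_one ρ) v
  · refine smul_left_injective ℂ hv ?_
    change ψ (x + y) • v = (ψ x * ψ y) • v
    rw [← hψ, ← zeta_mul, map_mul, Module.End.mul_apply, hψ, hψ, smul_smul, mul_comm]

variable {ρ} {ψ : AddChar (ZMod p) ℂ}

/-- If the centre acts nontrivially, the invariant Lagrangian has a nonzero fixed vector. -/
theorem exists_fixed_lagr (hp5 : 5 ≤ p) (hψ : ∀ w v, ρ (zeta w) v = ψ w • v) (hψ1 : ψ ≠ 1) :
    ∃ v ≠ 0, ∀ a b, ρ (lagr a b) v = v := by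
  have : NeZero p := ⟨(Fact.out : p.Prime).ne_zero⟩
  have h2 := two_ne_zero' hp5
  have h6 := six_ne_zero' hp5
  obtain ⟨w, -, hw, χ, hχ⟩ := exists_joint_eigenvector_s11
    (fun q : ZMod p × ZMod p => ρ (lagr q.1 q.2))
    (fun q r => by
      rw [commute_iff_eq, ← map_mul, ← map_mul, lagr_mul, lagr_mul, add_comm q.1, add_comm q.2])
    ⊤ (Representation.IsIrreducible.top_ne_bot ρ) (fun _ _ _ => Submodule.mem_top)
  have hpow : ∀ q (n : ℕ), ρ (lagr (n * q.1) (n * q.2)) w = χ q ^ n • w := by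
    intro q n
    rw [← lagr_pow]
    induction n with
    | zero => simp
    | succ n ih => rw [pow_succ', map_mul, Module.End.mul_apply, ih, map_smul, hχ, smul_smul,
        pow_succ]
  have hroot : ∀ q, (χ q)⁻¹ ^ p = 1 := by
    intro q
    have h := hpow q p
    rw [CharP.cast_eq_zero, zero_mul, zero_mul, show lagr (0 : ZMod p) 0 = 1 from rfl, map_one,
      Module.End.one_apply] at h
    have h1 : χ q ^ p = 1 := smul_left_injective ℂ hw (by simpa using h.symm)
    rw [inv_pow, h1, inv_one]
  obtain ⟨k, hk⟩ := AddChar.exists_apply_eq_of_pow_eq_one hψ1 (hroot (1, 0))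
  obtain ⟨l, hl⟩ := AddChar.exists_apply_eq_of_pow_eq_one hψ1 (hroot (0, 1))
  have hne : ∀ q, χ q ≠ 0 := fun q h => by
    have := hroot q
    rw [h, inv_zero, zero_pow (NeZero.ne p)] at this
    exact zero_ne_one this
  set v := ρ (colagr (-l / 2) (k / 6)) w with hv
  have hv0 : v ≠ 0 := fun h => hw (by
    simpa [v, ← Module.End.mul_apply, ← map_mul] using
      congrArg (ρ (colagr (-l / 2) (k / 6))⁻¹) h)
  have hfix : ∀ a b, ρ (lagr a b) v = (ψ (a * k + b * l) * χ (a, b)) • v := by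
    intro a b
    rw [hv, apply_lagr_apply_colagr hψ, hχ (a, b), map_smul, smul_smul]
    congr 3
    field_simp
    ring
  have h10 : ρ (lagr 1 0) v = v := by
    rw [hfix, one_mul, zero_mul, add_zero, hk, inv_mul_cancel₀ (hne _), one_smul]
  have h01 : ρ (lagr 0 1) v = v := by
    rw [hfix, one_mul, zero_mul, zero_add, hl, inv_mul_cancel₀ (hne _), one_smul]
  have hfixpow : ∀ g : ShiftGroup p, ρ g v = v → ∀ n : ℕ, ρ (g ^ n) v = v := by
    intro g hg n
    induction n with
    | zero => simp
    | succ n ih => rw [pow_succ, map_mul, Module.End.mul_apply, hg, ih]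
  refine ⟨v, hv0, fun a b => ?_⟩
  have hab : lagr a b = lagr 1 0 ^ a.val * lagr 0 1 ^ b.val := by
    rw [lagr_pow, lagr_pow, lagr_mul]
    simp
  rw [hab, map_mul, Module.End.mul_apply, hfixpow _ h01, hfixpow _ h10]

theorem finrank_eq_sq (hp5 : 5 ≤ p) (hψ : ∀ w v, ρ (zeta w) v = ψ w • v) (hψ1 : ψ ≠ 1) :
    Module.finrank ℂ V = p ^ 2 := by
  have : NeZero p := ⟨(Fact.out : p.Prime).ne_zero⟩
  have h2 := two_ne_zero' hp5
  have h6 := six_ne_zero' hp5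
  let W : Submodule ℂ V := ⨅ q : ZMod p × ZMod p, Module.End.eigenspace (ρ (lagr q.1 q.2)) 1
  have hW : ∀ v, v ∈ W ↔ ∀ a b, ρ (lagr a b) v = v := by simp [W]
  obtain ⟨v₀, hv₀, hfix₀⟩ := exists_fixed_lagr hp5 hψ hψ1
  obtain ⟨v, hvW, hv, χ, hχ⟩ := exists_joint_eigenvector_s11 (fun t : ZMod p => ρ (shift t))
    (commute_apply_shift ρ) W (W.ne_bot_iff.2 ⟨v₀, (hW v₀).2 hfix₀, hv₀⟩) (fun t v hv => by
      rw [hW] at hv ⊢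
      intro a b
      rw [← Module.End.mul_apply, ← map_mul, lagr_mul_shift, map_mul, Module.End.mul_apply, hv])
  rw [hW] at hvW
  have hs : ∀ g, ∃ q : ZMod p × ZMod p, ∃ c : ℂ, ρ g v = c • ρ (colagr q.1 q.2) v := by
    intro g
    refine ⟨(g.c, g.d), ψ (g.z - (g.c * g.b - 3 * (g.d * g.a))) * χ g.t, ?_⟩
    conv_lhs => rw [eq_colagr_mul g]
    simp only [map_mul, Module.End.mul_apply, hχ, map_smul, hvW, hψ, smul_smul]
    rw [mul_comm]
  have hinj : Function.Injective fun (q : ZMod p × ZMod p) (r : Multiplicative (ZMod p × ZMod p)) =>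
      ψ (6 * (r.toAdd.1 * q.2) - 2 * (r.toAdd.2 * q.1)) := by
    intro q r hqr
    have hprim := AddChar.IsPrimitive.of_ne_one hψ1
    have h1 : ψ.mulShift (6 * q.2) = ψ.mulShift (6 * r.2) := by
      ext a
      have := congrFun hqr (Multiplicative.ofAdd (a, 0))
      simpa [mul_assoc, mul_comm a] using this
    have h3 : ψ.mulShift (-2 * q.1) = ψ.mulShift (-2 * r.1) := by
      ext a
      have := congrFun hqr (Multiplicative.ofAdd (0, a))
      simpa [mul_assoc, mul_comm a] using this
    exact Prod.ext
      (mul_left_cancel₀ (neg_ne_zero.2 h2) (AddChar.to_mulShift_inj_of_isPrimitive hprim h3))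
      (mul_left_cancel₀ h6 (AddChar.to_mulShift_inj_of_isPrimitive hprim h1))
  rw [Representation.IsIrreducible.finrank_eq_card_s11 ρ (lagrHom p)
    (fun q : ZMod p × ZMod p => colagr q.1 q.2) hv hs _ hinj fun q r => ?_]
  · simp [ZMod.card, sq]
  · change ρ (lagr _ _) _ = _
    rw [apply_lagr_apply_colagr hψ, hvW]

theorem finrank_eq_one_or_eq (h1 : ∀ w, ρ (zeta w) = 1) :
    Module.finrank ℂ V = 1 ∨ Module.finrank ℂ V = p := by
  have : NeZero p := ⟨(Fact.out : p.Prime).ne_zero⟩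
  have hcomm : ∀ x y : heis p, Commute (ρ x) (ρ y) := by
    intro x y
    have hxy : (x * y : ShiftGroup p) = ⁅(x : ShiftGroup p), (y : ShiftGroup p)⁆ * (y * x) := by
      rw [commutatorElement_def]; group
    rw [commute_iff_eq, ← map_mul, ← map_mul, hxy, commutatorElement_of_mem_heis x.2 y.2, map_mul,
      h1, one_mul]
  obtain ⟨v, -, hv, χ, hχ⟩ := exists_joint_eigenvector_s11 (fun x : heis p => ρ x) hcomm ⊤
    (Representation.IsIrreducible.top_ne_bot ρ) (fun _ _ _ => Submodule.mem_top)
  have hconj : ∀ (x : heis p) (t : ZMod p), (x : ShiftGroup p) * shift t =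
      shift t * (MulAut.conjNormal (shift t)⁻¹ x : heis p) := by
    intro x t
    rw [MulAut.conjNormal_apply]
    group
  let stab : Subgroup (ShiftGroup p) :=
    { carrier := {g | ∀ x, χ (MulAut.conjNormal g x) = χ x}
      one_mem' := by simp
      mul_mem' := fun {g h} hg hh x => by
        rw [map_mul, MulAut.mul_apply, hg, hh]
      inv_mem' := fun {g} hg x => by
        rw [← hg, ← MulAut.mul_apply, ← map_mul, mul_inv_cancel, map_one, MulAut.one_apply] }
  by_cases hinj : Function.Injective
      fun (t : ZMod p) (x : heis p) => χ (MulAut.conjNormal (shift t)⁻¹ x)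
  · right
    rw [Representation.IsIrreducible.finrank_eq_card_s11 ρ (heis p).subtype shift hv
      (fun g => ⟨g.t, χ ⟨_, shift_neg_mul_mem_heis g⟩, ?_⟩) _ hinj (fun t x => ?_), ZMod.card]
    · have hg : g = shift g.t * (shift (-g.t) * g) := by
        rw [← mul_assoc, shift_mul, add_neg_cancel]
        exact (one_mul g).symm
      conv_lhs => rw [hg]
      rw [map_mul, Module.End.mul_apply, hχ ⟨_, shift_neg_mul_mem_heis g⟩, map_smul]
    · rw [Subgroup.coe_subtype, ← Module.End.mul_apply, ← map_mul, hconj, map_mul,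
        Module.End.mul_apply, hχ, map_smul]
  · left
    obtain ⟨s, t, hst, hne⟩ : ∃ s t : ZMod p,
        (∀ x : heis p, χ (MulAut.conjNormal (shift s)⁻¹ x) = χ (MulAut.conjNormal (shift t)⁻¹ x)) ∧
          s ≠ t := by
      simp only [Function.Injective, not_forall] at hinj
      obtain ⟨s, t, hst, hne⟩ := hinj
      exact ⟨s, t, congrFun hst, hne⟩
    have hstab : ∀ r, shift r ∈ stab := by
      have hk : shift (s - t) ∈ stab := by
        intro x
        have h := hst (MulAut.conjNormal (shift s) x)
        simp only [← MulAut.mul_apply, ← map_mul] at h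
        rw [inv_mul_cancel, map_one, MulAut.one_apply] at h
        rw [h]
        congr 3
        rw [eq_inv_mul_iff_mul_eq, shift_mul, add_sub_cancel]
      intro r
      have hr : shift r = shift (s - t) ^ (r / (s - t)).val := by
        rw [shift_pow, ZMod.natCast_zmod_val, div_mul_cancel₀ _ (sub_ne_zero.2 hne)]
      rw [hr]
      exact stab.pow_mem hk _
    let W : Submodule ℂ V := ⨅ x : heis p, Module.End.eigenspace (ρ x) (χ x)
    have hW : ∀ w, w ∈ W ↔ ∀ x : heis p, ρ x w = χ x • w := by simp [W]
    obtain ⟨w, hwW, hw, θ, hθ⟩ := exists_joint_eigenvector_s11 (fun t : ZMod p => ρ (shift t))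
      (commute_apply_shift ρ) W (W.ne_bot_iff.2 ⟨v, (hW v).2 hχ, hv⟩) (fun t w hw => by
        rw [hW] at hw ⊢
        intro x
        rw [← Module.End.mul_apply, ← map_mul, hconj, map_mul, Module.End.mul_apply, hw, map_smul,
          stab.inv_mem (hstab t)])
    rw [hW] at hwW
    refine Representation.IsIrreducible.finrank_eq_one_of_eigenvector ρ hw fun g =>
      ⟨χ ⟨_, shift_neg_mul_mem_heis g⟩ * θ g.t, ?_⟩
    have hg : g = shift g.t * (shift (-g.t) * g) := by
      rw [← mul_assoc, shift_mul, add_neg_cancel]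
      exact (one_mul g).symm
    conv_lhs => rw [hg]
    rw [map_mul, Module.End.mul_apply, hwW ⟨_, shift_neg_mul_mem_heis g⟩, map_smul, hθ, smul_smul]

end Representations

open CategoryTheory

theorem charDegrees_eq [Fact p.Prime] (hp5 : 5 ≤ p) :
    charDegrees (ShiftGroup p) = {1, p, p ^ 2} := by
  have : NeZero p := ⟨(Fact.out : p.Prime).ne_zero⟩
  ext d
  simp only [Set.mem_insert_iff, Set.mem_singleton_iff]
  constructor
  · rintro ⟨V, hV, rfl⟩
    have := FDRep.isIrreducible_of_simple_s11 V
    obtain ⟨ψ, hψ⟩ := exists_centralChar V.ρ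
    by_cases h : ψ = 1
    · rcases finrank_eq_one_or_eq (ρ := V.ρ) (fun w => LinearMap.ext fun v => by simp [hψ, h])
        with h | h
      · exact Or.inl h
      · exact Or.inr (Or.inl h)
    · exact Or.inr (Or.inr (finrank_eq_sq hp5 hψ h))
  · rintro (rfl | rfl | rfl)
    · let ρ := Representation.trivial ℂ (ShiftGroup p) ℂ
      have : ρ.IsIrreducible :=
        { exists_pair_ne := ⟨⊥, ⊤, fun h => bot_ne_top (α := Submodule ℂ ℂ)
            (congrArg Subrepresentation.toSubmodule h)⟩
          eq_bot_or_eq_top := fun W => (eq_bot_or_eq_top W.toSubmodule).imp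
            (fun h => Subrepresentation.toSubmodule_injective h)
            (fun h => Subrepresentation.toSubmodule_injective h) }
      exact ⟨FDRep.of ρ, FDRep.simple_of_isIrreducible ρ, Module.finrank_self ℂ⟩
    · obtain ⟨V, hV, hN, hg⟩ := FDRep.exists_simple_apply_ne_one (centre d)
        (commutatorElement_shift_notMem_centre hp5)
      have := FDRep.isIrreducible_of_simple_s11 V
      refine ⟨V, hV, (finrank_eq_one_or_eq (ρ := V.ρ)
        fun w => hN _ (zeta_mem_centre w)).resolve_left fun h => hg ?_⟩
      exact Representation.apply_commutatorElement_of_finrank_eq_one V.ρ h _ _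
    · obtain ⟨V, hV, -, hg⟩ := FDRep.exists_simple_apply_ne_one (⊥ : Subgroup (ShiftGroup p))
        (g := zeta 1) (fun h => one_ne_zero (congrArg ShiftGroup.z (Subgroup.mem_bot.1 h)))
      have := FDRep.isIrreducible_of_simple_s11 V
      obtain ⟨ψ, hψ⟩ := exists_centralChar V.ρ
      refine ⟨V, hV, finrank_eq_sq hp5 hψ fun h => hg (LinearMap.ext fun v => ?_)⟩
      simp [hψ, h]

end ShiftGroup

theorem exists_group_p6_dl_three_extraspecial_exponent_p (p : ℕ)
    (hp : p.Prime) (hp5 : 5 ≤ p) :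
    ∃ (P : Type) (_ : Group P) (_ : Finite P),
      Nat.card P = p ^ 6 ∧
      derivedSeries P 2 ≠ ⊥ ∧ derivedSeries P 3 = ⊥ ∧
      charDegrees P = {1, p, p ^ 2} ∧
      ∃ G : Subgroup P, G.Normal ∧ G.index = p ∧
        IsExtraspecial p ↥G ∧ Nat.card ↥G = p ^ 5 ∧
        ∀ g ∈ G, g ^ p = 1 := by
  have : Fact p.Prime := ⟨hp⟩
  exact ⟨ShiftGroup p, inferInstance, inferInstance, ShiftGroup.card_eq,
    ShiftGroup.derivedSeries_two_ne_bot hp5, ShiftGroup.derivedSeries_three,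
    ShiftGroup.charDegrees_eq hp5, ShiftGroup.heis p, inferInstance, ShiftGroup.index_heis,
    ShiftGroup.isExtraspecial_heis hp5, ShiftGroup.card_heis,
    fun _ hg => ShiftGroup.pow_p_of_mem_heis hg⟩
end
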